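/- arXiv:1811.02023 — 5 statements merged into one kernel-verified Lean document; each statement's English description precedes it below -/
import Mathlib

section
/- The cut-shift distance d△ is a pseudometric on the space of orderons: for all orderons W, U, Z one has d△(W,U) ≥ 0, d△(W,W) = 0, d△(W,U) = d△(U,W), and d△(W,U) ≤ d△(W,Z) + d△(Z,U). -/
open MeasureTheory Real Filter
open scoped ENNReal Classical

noncomputable section

/-- The unit interval `[0,1]` as a subtype of `ℝ`. -/
abbrev UI : Type := Set.Icc (0:ℝ) 1

/-- The unit square `[0,1]²`. -/
abbrev USq : Type := UI × UI

/-- An orderon: a symmetric measurable function `([0,1]²)² → [0,1]`. -/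
def IsOrderon (W : USq → USq → ℝ) : Prop :=
  Measurable (Function.uncurry W) ∧ (∀ u v, W u v ∈ Set.Icc (0:ℝ) 1) ∧
    ∀ u v, W u v = W v u

/-- The (unordered) cut norm: `sup_{S,T} |∫_{S×T} W|` over measurable `S,T ⊆ [0,1]²`. -/
def cutNorm (W : USq → USq → ℝ) : ℝ :=
  sSup {x | ∃ S T : Set USq, MeasurableSet S ∧ MeasurableSet T ∧
    x = |∫ p in S ×ˢ T, W p.1 p.2|}

/-- A measure-preserving bijection of `[0,1]²` with measure-preserving inverse. -/
def IsMPB (f : USq → USq) : Prop :=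
  MeasurePreserving f volume volume ∧
  ∃ g : USq → USq, MeasurePreserving g volume volume ∧
    Function.LeftInverse g f ∧ Function.RightInverse g f

/-- `Shift(f) = sup_{(x,a)} |x - π₁(f(x,a))|`. -/
def shiftOf (f : USq → USq) : ℝ := ⨆ u : USq, |(u.1 : ℝ) - ((f u).1 : ℝ)|

/-- The cut-shift distance `d△(W,U) = inf_f (Shift(f) + ‖W - U^f‖_□)`. -/
def csDist (W U : USq → USq → ℝ) : ℝ :=
  sInf {x | ∃ f : USq → USq, IsMPB f ∧
    x = shiftOf f + cutNorm (fun u v => W u v - U (f u) (f v))}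

/-- A measurable kernel on the unit square with values in `[-1,1]`. -/
def IsUnitKernel (A : USq → USq → ℝ) : Prop :=
  Measurable (Function.uncurry A) ∧ ∀ u v, |A u v| ≤ 1

lemma isUnitKernel_sub_comp {W U : USq → USq → ℝ} (hW : IsOrderon W) (hU : IsOrderon U)
    {f : USq → USq} (hf : Measurable f) :
    IsUnitKernel (fun u v => W u v - U (f u) (f v)) := by
  refine ⟨hW.1.sub (hU.1.comp (hf.prodMap hf)), fun u v => ?_⟩
  have h₁ := hW.2.1 u v
  have h₂ := hU.2.1 (f u) (f v)
  rw [Set.mem_Icc] at h₁ h₂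
  rw [abs_le]
  constructor <;> linarith

lemma IsUnitKernel.integrable {A : USq → USq → ℝ} (hA : IsUnitKernel A) :
    Integrable (fun p : USq × USq => A p.1 p.2) :=
  Integrable.of_bound hA.1.aestronglyMeasurable 1
    (Eventually.of_forall fun p => hA.2 p.1 p.2)

lemma IsUnitKernel.abs_setIntegral_le_cutNorm {A : USq → USq → ℝ} (hA : IsUnitKernel A)
    {S T : Set USq} (hS : MeasurableSet S) (hT : MeasurableSet T) :
    |∫ p in S ×ˢ T, A p.1 p.2| ≤ cutNorm A := by
  refine le_csSup ⟨1, ?_⟩ ⟨S, T, hS, hT, rfl⟩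
  rintro _ ⟨S, T, -, -, rfl⟩
  have h := norm_setIntegral_le_of_norm_le_const (μ := (volume : Measure (USq × USq)))
    (s := S ×ˢ T) (f := fun p => A p.1 p.2) (C := 1) (measure_lt_top _ _)
    (fun p _ => hA.2 p.1 p.2)
  rw [Real.norm_eq_abs, one_mul] at h
  exact h.trans measureReal_le_one

lemma cutNorm_nonneg (A : USq → USq → ℝ) : 0 ≤ cutNorm A := by
  refine Real.sSup_nonneg ?_
  rintro _ ⟨S, T, -, -, rfl⟩
  exact abs_nonneg _

lemma cutNorm_le {A : USq → USq → ℝ} {c : ℝ}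
    (h : ∀ S T : Set USq, MeasurableSet S → MeasurableSet T →
      |∫ p in S ×ˢ T, A p.1 p.2| ≤ c) : cutNorm A ≤ c := by
  refine csSup_le ⟨_, ∅, ∅, .empty, .empty, rfl⟩ ?_
  rintro _ ⟨S, T, hS, hT, rfl⟩
  exact h S T hS hT

lemma cutNorm_add_le {A B : USq → USq → ℝ} (hA : IsUnitKernel A) (hB : IsUnitKernel B) :
    cutNorm (fun u v => A u v + B u v) ≤ cutNorm A + cutNorm B := by
  refine cutNorm_le fun S T hS hT => ?_
  rw [integral_add hA.integrable.integrableOn hB.integrable.integrableOn]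
  exact (abs_add_le _ _).trans (add_le_add (hA.abs_setIntegral_le_cutNorm hS hT)
    (hB.abs_setIntegral_le_cutNorm hS hT))

lemma cutNorm_neg (A : USq → USq → ℝ) : cutNorm (fun u v => -A u v) = cutNorm A := by
  simp only [cutNorm, integral_neg, abs_neg]

/-- An invertible measure-preserving map as a measurable equivalence. -/
lemma IsMPB.exists_measurableEquiv {f : USq → USq} (hf : IsMPB f) :
    ∃ e : USq ≃ᵐ USq, ⇑e = f := by
  obtain ⟨hf, g, hg, hl, hr⟩ := hf
  exact ⟨⟨⟨f, g, hl, hr⟩, hf.measurable, hg.measurable⟩, rfl⟩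

lemma cutNorm_comp_le {A : USq → USq → ℝ} (hA : IsUnitKernel A) {f : USq → USq}
    (hf : IsMPB f) : cutNorm (fun u v => A (f u) (f v)) ≤ cutNorm A := by
  refine cutNorm_le fun S T hS hT => ?_
  obtain ⟨e, rfl⟩ := hf.exists_measurableEquiv
  have h := (hf.1.prod hf.1).setIntegral_preimage_emb
    (e.prodCongr e).measurableEmbedding (fun p => A p.1 p.2)
    ((e.symm ⁻¹' S) ×ˢ (e.symm ⁻¹' T))
  have hpre : Prod.map e e ⁻¹' ((e.symm ⁻¹' S) ×ˢ (e.symm ⁻¹' T)) = S ×ˢ T := by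
    ext p
    simp
  rw [hpre] at h
  refine (congrArg abs h).trans_le ?_
  exact hA.abs_setIntegral_le_cutNorm (e.symm.measurable hS) (e.symm.measurable hT)

lemma isMPB_id : IsMPB id :=
  ⟨.id _, id, .id _, fun _ => rfl, fun _ => rfl⟩

lemma IsMPB.comp {f h : USq → USq} (hh : IsMPB h) (hf : IsMPB f) : IsMPB (h ∘ f) := by
  obtain ⟨hf, g, hg, hl, hr⟩ := hf
  obtain ⟨hh, k, hk, hl', hr'⟩ := hh
  exact ⟨hh.comp hf, g ∘ k, hg.comp hk, hl'.comp hl, hr'.comp hr⟩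

lemma le_shiftOf (f : USq → USq) (u : USq) : |(u.1 : ℝ) - ((f u).1 : ℝ)| ≤ shiftOf f := by
  refine le_ciSup (f := fun u : USq => |(u.1 : ℝ) - ((f u).1 : ℝ)|) ⟨1, ?_⟩ u
  rintro _ ⟨u, rfl⟩
  have h₁ := u.1.2
  have h₂ := (f u).1.2
  rw [Set.mem_Icc] at h₁ h₂
  rw [abs_le]
  constructor <;> linarith

lemma shiftOf_nonneg (f : USq → USq) : 0 ≤ shiftOf f :=
  Real.iSup_nonneg fun _ => abs_nonneg _

lemma shiftOf_id : shiftOf id = 0 := by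
  simp [shiftOf]

lemma shiftOf_comp_le (f h : USq → USq) : shiftOf (h ∘ f) ≤ shiftOf f + shiftOf h :=
  ciSup_le fun u => (abs_sub_le _ ((f u).1 : ℝ) _).trans
    (add_le_add (le_shiftOf f u) (le_shiftOf h (f u)))

lemma shiftOf_le_of_rightInverse {f g : USq → USq} (h : Function.RightInverse g f) :
    shiftOf g ≤ shiftOf f := by
  refine ciSup_le fun u => ?_
  have := le_shiftOf f (g u)
  rwa [h u, abs_sub_comm] at this

lemma csDist_le (W U : USq → USq → ℝ) {f : USq → USq} (hf : IsMPB f) :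
    csDist W U ≤ shiftOf f + cutNorm (fun u v => W u v - U (f u) (f v)) := by
  refine csInf_le ⟨0, ?_⟩ ⟨f, hf, rfl⟩
  rintro _ ⟨f, -, rfl⟩
  exact add_nonneg (shiftOf_nonneg _) (cutNorm_nonneg _)

lemma le_csDist {W U : USq → USq → ℝ} {c : ℝ}
    (h : ∀ f, IsMPB f → c ≤ shiftOf f + cutNorm (fun u v => W u v - U (f u) (f v))) :
    c ≤ csDist W U := by
  refine le_csInf ⟨_, id, isMPB_id, rfl⟩ ?_
  rintro _ ⟨f, hf, rfl⟩
  exact h f hf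

lemma csDist_nonneg (W U : USq → USq → ℝ) : 0 ≤ csDist W U :=
  le_csDist fun _ _ => add_nonneg (shiftOf_nonneg _) (cutNorm_nonneg _)

lemma csDist_self (W : USq → USq → ℝ) : csDist W W = 0 := by
  refine le_antisymm ((csDist_le W W isMPB_id).trans ?_) (csDist_nonneg W W)
  rw [shiftOf_id, zero_add]
  exact cutNorm_le fun S T _ _ => by simp

lemma csDist_le_swap {W U : USq → USq → ℝ} (hW : IsOrderon W) (hU : IsOrderon U) :
    csDist W U ≤ csDist U W := by
  refine le_csDist fun f hf => ?_
  obtain ⟨hf', g, hg, hl, hr⟩ := hf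
  have hgM : IsMPB g := ⟨hg, f, hf', hr, hl⟩
  refine (csDist_le W U hgM).trans (add_le_add (shiftOf_le_of_rightInverse hr) ?_)
  have h := cutNorm_comp_le (isUnitKernel_sub_comp hU hW hf'.measurable) hgM
  rw [← cutNorm_neg] at h
  simpa only [hr _, neg_sub] using h

lemma csDist_triangle {W U Z : USq → USq → ℝ} (hW : IsOrderon W) (hU : IsOrderon U)
    (hZ : IsOrderon Z) : csDist W U ≤ csDist W Z + csDist Z U := by
  rw [← sub_le_iff_le_add]
  refine le_csDist fun f hf => ?_
  rw [sub_le_comm]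
  refine le_csDist fun h hh => ?_
  have hA := isUnitKernel_sub_comp hW hZ hf.1.measurable
  have hB := isUnitKernel_sub_comp hZ hU hh.1.measurable
  have hBf : IsUnitKernel fun u v => Z (f u) (f v) - U (h (f u)) (h (f v)) :=
    ⟨hB.1.comp (hf.1.measurable.prodMap hf.1.measurable), fun u v => hB.2 (f u) (f v)⟩
  have h₁ := cutNorm_add_le hA hBf
  simp only [sub_add_sub_cancel] at h₁
  have h₂ := cutNorm_comp_le hB hf
  have h₃ := csDist_le W U (hh.comp hf)
  have h₄ := shiftOf_comp_le f h
  simp only [Function.comp_apply] at h₃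
  linarith

/-- The cut-shift distance is a pseudometric on the space of orderons. -/
theorem csDist_pseudometric (W U Z : USq → USq → ℝ)
    (hW : IsOrderon W) (hU : IsOrderon U) (hZ : IsOrderon Z) :
    0 ≤ csDist W U ∧ csDist W W = 0 ∧ csDist W U = csDist U W ∧
      csDist W U ≤ csDist W Z + csDist Z U := by
  exact ⟨csDist_nonneg W U, csDist_self W,
    le_antisymm (csDist_le_swap hW hU) (csDist_le_swap hU hW), csDist_triangle hW hU hZ⟩
end
end

section
/- Let W : ([0,1]^2)^2 → [−1,1] be a symmetric measurable function. Then ‖W‖_□'^2/4 ≤ ‖W‖_□ ≤ 2‖W‖_□'. -/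
open MeasureTheory Real Filter
open scoped ENNReal Classical

noncomputable section

/-- The ordered cut norm: `sup_{S,T} |∫_{S×T} W(u,v)·1[π₁(u) ≤ π₁(v)]|`. -/
def ordCutNorm (W : USq → USq → ℝ) : ℝ :=
  sSup {x | ∃ S T : Set USq, MeasurableSet S ∧ MeasurableSet T ∧
    x = |∫ p in S ×ˢ T, (if ((p.1.1 : ℝ)) ≤ ((p.2.1 : ℝ)) then W p.1 p.2 else 0)|}

instance : IsProbabilityMeasure (volume : Measure UI) :=
  inferInstanceAs (IsProbabilityMeasure (volume : Measure unitInterval))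

lemma measurableSet_fst_le : MeasurableSet {p : USq × USq | (p.1.1 : ℝ) ≤ p.2.1} :=
  measurableSet_le (by fun_prop) (by fun_prop)

lemma measurableSet_strip (δ : ℝ) :
    MeasurableSet {p : USq × USq | (p.1.1 : ℝ) ≤ p.2.1 ∧ (p.2.1 : ℝ) ≤ p.1.1 + δ} := by
  have hle : MeasurableSet {p : USq × USq | (p.2.1 : ℝ) ≤ p.1.1 + δ} :=
    measurableSet_le (by fun_prop) (by fun_prop)
  exact measurableSet_fst_le.inter hle

lemma volume_strip_le (δ : ℝ) :
    volume {p : USq × USq | (p.1.1 : ℝ) ≤ p.2.1 ∧ (p.2.1 : ℝ) ≤ p.1.1 + δ} ≤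
      ENNReal.ofReal δ := by
  rw [Measure.volume_eq_prod, Measure.prod_apply (measurableSet_strip δ)]
  calc _ ≤ ∫⁻ _ : USq, ENNReal.ofReal δ := by
        refine lintegral_mono fun u => ?_
        have hset : Prod.mk u ⁻¹' {p : USq × USq | (p.1.1 : ℝ) ≤ p.2.1 ∧ (p.2.1 : ℝ) ≤ p.1.1 + δ}
            = ((↑) ⁻¹' Set.Icc (u.1 : ℝ) (u.1 + δ) : Set UI) ×ˢ (Set.univ : Set UI) := by
          ext v; simp
        rw [hset, Measure.volume_eq_prod, Measure.prod_prod, measure_univ, mul_one,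
          Measure.Subtype.volume_def, comap_subtype_coe_apply measurableSet_Icc]
        exact (measure_mono (Set.image_preimage_subset _ _)).trans (by simp)
    _ = ENNReal.ofReal δ := by simp

lemma abs_setIntegral_le_measureReal {α : Type*} [MeasurableSpace α] {μ : Measure α}
    [IsFiniteMeasure μ] {f : α → ℝ} (hf : ∀ p, |f p| ≤ 1) (s : Set α) :
    |∫ p in s, f p ∂μ| ≤ μ.real s := by
  simpa using norm_setIntegral_le_of_norm_le_const (μ := μ) (f := f) (s := s) (C := 1)
    (measure_lt_top _ _) fun p _ => hf p

lemma le_cutNorm {W : USq → USq → ℝ} (hW : ∀ u v, |W u v| ≤ 1) {S T : Set USq}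
    (hS : MeasurableSet S) (hT : MeasurableSet T) :
    |∫ p in S ×ˢ T, W p.1 p.2| ≤ cutNorm W := by
  refine le_csSup ⟨1, ?_⟩ ⟨S, T, hS, hT, rfl⟩
  rintro x ⟨S, T, -, -, rfl⟩
  exact (abs_setIntegral_le_measureReal (fun p : USq × USq => hW p.1 p.2) _).trans
    measureReal_le_one

lemma le_ordCutNorm {W : USq → USq → ℝ} (hW : ∀ u v, |W u v| ≤ 1) {S T : Set USq}
    (hS : MeasurableSet S) (hT : MeasurableSet T) :
    |∫ p in S ×ˢ T, (if ((p.1.1 : ℝ)) ≤ ((p.2.1 : ℝ)) then W p.1 p.2 else 0)| ≤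
      ordCutNorm W := by
  refine le_csSup ⟨1, ?_⟩ ⟨S, T, hS, hT, rfl⟩
  rintro x ⟨S, T, -, -, rfl⟩
  refine (abs_setIntegral_le_measureReal (fun p => ?_) _).trans measureReal_le_one
  split_ifs
  · exact hW _ _
  · simp

lemma integrable_of_abs_le_one {f : USq × USq → ℝ} (hf : Measurable f) (hb : ∀ p, |f p| ≤ 1) :
    Integrable f :=
  .of_bound hf.aestronglyMeasurable 1 (.of_forall hb)

lemma cutNorm_le_two_mul_ordCutNorm {W : USq → USq → ℝ}
    (hmeas : Measurable (Function.uncurry W)) (hsym : ∀ u v, W u v = W v u)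
    (hW : ∀ u v, |W u v| ≤ 1) : cutNorm W ≤ 2 * ordCutNorm W := by
  refine csSup_le ⟨_, ∅, ∅, .empty, .empty, rfl⟩ ?_
  rintro x ⟨S, T, hS, hT, rfl⟩
  set F : USq × USq → ℝ :=
    fun p => if ((p.1.1 : ℝ)) ≤ ((p.2.1 : ℝ)) then W p.1 p.2 else 0 with hF
  have hFm : Measurable F := Measurable.ite measurableSet_fst_le hmeas measurable_const
  have hFb : ∀ p, |F p| ≤ 1 := fun p => by
    simp only [hF]
    split_ifs
    · exact hW _ _
    · simp
  have hdiag : ∀ᵐ p : USq × USq, (p.1.1 : ℝ) ≠ p.2.1 := by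
    rw [ae_iff]
    refine measure_mono_null (fun p hp => ?_) (le_antisymm ((volume_strip_le 0).trans (by simp))
      zero_le)
    have hp' : (p.1.1 : ℝ) = p.2.1 := by simpa using hp
    exact ⟨hp'.le, by linarith⟩
  have hsplit : ∫ p in S ×ˢ T, W p.1 p.2 = (∫ p in S ×ˢ T, F p) + ∫ p in T ×ˢ S, F p := by
    have hswap : ∫ p in T ×ˢ S, F p = ∫ p in S ×ˢ T, F p.swap :=
      (setIntegral_prod_swap (μ := volume) (ν := volume) T S F).symm
    rw [hswap, ← integral_add (integrable_of_abs_le_one hFm hFb).integrableOn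
      (integrable_of_abs_le_one (f := fun p => F p.swap)
        (hFm.comp measurable_swap) fun p => hFb _).integrableOn]
    refine integral_congr_ae (ae_restrict_of_ae ?_)
    filter_upwards [hdiag] with p hp
    rcases lt_or_gt_of_ne hp with h | h
    · simp only [hF, Prod.fst_swap, Prod.snd_swap, if_pos h.le, if_neg (not_le.mpr h), add_zero]
    · simp only [hF, Prod.fst_swap, Prod.snd_swap, if_pos h.le, if_neg (not_le.mpr h), zero_add,
        hsym p.1 p.2]
  rw [hsplit, two_mul]
  exact (abs_add_le _ _).trans (add_le_add (le_ordCutNorm hW hS hT) (le_ordCutNorm hW hT hS))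

lemma ordCutNorm_le {W : USq → USq → ℝ} (hmeas : Measurable (Function.uncurry W))
    (hW : ∀ u v, |W u v| ≤ 1) (n : ℕ) : ordCutNorm W ≤ n * cutNorm W + 1 / (n + 1) := by
  refine csSup_le ⟨_, ∅, ∅, .empty, .empty, rfl⟩ ?_
  rintro x ⟨S, T, hS, hT, rfl⟩
  set L : Set (USq × USq) := {p | (p.1.1 : ℝ) ≤ p.2.1} with hL
  have hn : (0 : ℝ) < n + 1 := by positivity
  set A : ℕ → Set USq := fun i => S ∩ {u | ⌊((n : ℝ) + 1) * (u.1 : ℝ)⌋₊ = i} with hA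
  set B : ℕ → Set USq := fun i => T ∩ {v | (i : ℝ) + 1 ≤ (n + 1) * (v.1 : ℝ)} with hB
  have hAm : ∀ i, MeasurableSet (A i) := fun i => hS.inter <|
    (Nat.measurable_floor.comp (by fun_prop :
      Measurable fun u : USq => ((n : ℝ) + 1) * (u.1 : ℝ))) (measurableSet_singleton i)
  have hBm : ∀ i, MeasurableSet (B i) := fun i => hT.inter <|
    measurableSet_le measurable_const (by fun_prop)
  set U : Set (USq × USq) := ⋃ i ∈ Finset.range n, A i ×ˢ B i with hU
  have hUm : MeasurableSet U :=
    Finset.measurableSet_biUnion _ fun i _ => (hAm i).prod (hBm i)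
  have hUsub : U ⊆ S ×ˢ T ∩ L := by
    intro p hp
    simp only [hU, Set.mem_iUnion] at hp
    obtain ⟨i, -, ⟨hpS, hpA⟩, hpT, hpB⟩ := hp
    refine ⟨⟨hpS, hpT⟩, ?_⟩
    have h1 := Nat.lt_floor_add_one (((n : ℝ) + 1) * (p.1.1 : ℝ))
    rw [show ⌊((n : ℝ) + 1) * (p.1.1 : ℝ)⌋₊ = i from hpA] at h1
    exact le_of_mul_le_mul_left (h1.le.trans hpB) hn
  have hint : Integrable fun p : USq × USq => W p.1 p.2 :=
    integrable_of_abs_le_one hmeas fun p => hW p.1 p.2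
  have hsum : ∫ p in U, W p.1 p.2 = ∑ i ∈ Finset.range n, ∫ p in A i ×ˢ B i, W p.1 p.2 := by
    refine integral_biUnion_finset _ (fun i _ => (hAm i).prod (hBm i)) ?_
      fun i _ => hint.integrableOn
    intro i _ j _ hij
    refine Set.disjoint_left.mpr fun p hi hj => hij ?_
    exact hi.1.2.symm.trans hj.1.2
  have hUle : |∫ p in U, W p.1 p.2| ≤ n * cutNorm W := by
    rw [hsum]
    refine (Finset.abs_sum_le_sum_abs _ _).trans ?_
    refine (Finset.sum_le_card_nsmul _ _ _ fun i _ => le_cutNorm hW (hAm i) (hBm i)).trans ?_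
    simp
  have hrest : (S ×ˢ T ∩ L) \ U ⊆
      {p : USq × USq | (p.1.1 : ℝ) ≤ p.2.1 ∧ (p.2.1 : ℝ) ≤ p.1.1 + 1 / (n + 1)} := by
    rintro p ⟨⟨⟨hpS, hpT⟩, hpL⟩, hpU⟩
    refine ⟨hpL, ?_⟩
    have hx0 : (0 : ℝ) ≤ p.1.1 := p.1.1.2.1
    have hy1 : (p.2.1 : ℝ) ≤ 1 := p.2.1.2.2
    have hfl := Nat.floor_le (mul_nonneg hn.le hx0)
    suffices ((n : ℝ) + 1) * (p.2.1 : ℝ) ≤ (n + 1) * p.1.1 + 1 by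
      refine le_of_mul_le_mul_left ?_ hn
      rwa [mul_add, mul_one_div_cancel hn.ne']
    by_cases hi : ⌊((n : ℝ) + 1) * (p.1.1 : ℝ)⌋₊ < n
    · by_contra! hlt
      refine hpU (Set.mem_biUnion (Finset.mem_coe.mpr (Finset.mem_range.mpr hi))
        ⟨⟨hpS, rfl⟩, hpT, ?_⟩)
      simp only [Set.mem_ofPred_eq]
      linarith
    · have : (n : ℝ) ≤ ⌊((n : ℝ) + 1) * (p.1.1 : ℝ)⌋₊ := by exact_mod_cast not_lt.mp hi
      nlinarith
  have hDle : |∫ p in (S ×ˢ T ∩ L) \ U, W p.1 p.2| ≤ 1 / (n + 1) := by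
    refine (abs_setIntegral_le_measureReal (fun p : USq × USq => hW p.1 p.2) _).trans ?_
    exact ENNReal.toReal_le_of_le_ofReal (by positivity)
      ((measure_mono hrest).trans (volume_strip_le _))
  have hind : ∫ p in S ×ˢ T, (if ((p.1.1 : ℝ)) ≤ ((p.2.1 : ℝ)) then W p.1 p.2 else 0) =
      ∫ p in S ×ˢ T ∩ L, W p.1 p.2 := by
    rw [← setIntegral_indicator measurableSet_fst_le]
    rfl
  rw [hind, ← Set.union_sdiff_cancel hUsub, setIntegral_union Set.disjoint_sdiff_right
    (((hS.prod hT).inter measurableSet_fst_le).diff hUm) hint.integrableOn hint.integrableOn]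
  exact (abs_add_le _ _).trans (add_le_add hUle hDle)

lemma sq_div_four_le_of_forall_nat {o c : ℝ} (ho : 0 ≤ o) (hc : 0 ≤ c)
    (h : ∀ n : ℕ, o ≤ n * c + 1 / (n + 1)) : o ^ 2 / 4 ≤ c := by
  suffices o ≤ 2 * √c by nlinarith [Real.sq_sqrt hc, Real.sqrt_nonneg c]
  rcases hc.eq_or_lt with rfl | hc
  · simpa using ge_of_tendsto' tendsto_one_div_add_atTop_nhds_zero_nat fun n => by simpa using h n
  · have hs := Real.sqrt_pos.mpr hc
    have h1 : (⌊1 / √c⌋₊ : ℝ) * √c ≤ 1 :=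
      (le_div_iff₀ hs).mp (Nat.floor_le (by positivity))
    have h2 : 1 / ((⌊1 / √c⌋₊ : ℝ) + 1) ≤ √c :=
      (one_div_le (by positivity) hs).mpr (Nat.lt_floor_add_one _).le
    have h3 := h ⌊1 / √c⌋₊
    nlinarith [Real.mul_self_sqrt hc.le]

/-- Relation between the ordered and unordered cut norms:
`‖W‖_□'²/4 ≤ ‖W‖_□ ≤ 2‖W‖_□'` for symmetric measurable `W` with values in `[-1,1]`. -/
theorem ordCutNorm_vs_cutNorm (W : USq → USq → ℝ)
    (hmeas : Measurable (Function.uncurry W))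
    (hsym : ∀ u v, W u v = W v u)
    (hbdd : ∀ u v, W u v ∈ Set.Icc (-1:ℝ) 1) :
    (ordCutNorm W)^2 / 4 ≤ cutNorm W ∧ cutNorm W ≤ 2 * ordCutNorm W := by
  have hW : ∀ u v, |W u v| ≤ 1 := fun u v => abs_le.mpr (hbdd u v)
  exact ⟨sq_div_four_le_of_forall_nat
    ((abs_nonneg _).trans (le_ordCutNorm hW .empty .empty))
    ((abs_nonneg _).trans (le_cutNorm hW .empty .empty)) (ordCutNorm_le hmeas hW),
    cutNorm_le_two_mul_ordCutNorm hmeas hsym hW⟩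
end
end

section
/- For every orderon W and every ε > 0 there is an orderon U which is a step function with at most ⌈2^{8/ε²}⌉ steps such that ‖W − U‖_□ ≤ ε. -/
open MeasureTheory Real Filter
open scoped ENNReal Classical

noncomputable section

/-- `U` is a step function with (at most) `k` steps: there is a partition of `[0,1]²`
into measurable sets `S 0, …, S (k-1)` such that `U` is constant on each `S i × S j`. -/
def IsStepFun (U : USq → USq → ℝ) (k : ℕ) : Prop :=
  ∃ S : Fin k → Set USq, (∀ i, MeasurableSet (S i)) ∧
    Pairwise (Function.onFun Disjoint S) ∧ (⋃ i, S i) = Set.univ ∧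
    ∀ i j : Fin k, ∀ u ∈ S i, ∀ v ∈ S j, ∀ u' ∈ S i, ∀ v' ∈ S j, U u v = U u' v'

/-- The average of `W` over each fibre of `F`, with value `0` on null fibres. -/
def fiberAverage {X κ : Type*} [MeasurableSpace X] (ρ : Measure X) (W : X → ℝ) (F : X → κ)
    (c : κ) : ℝ :=
  ⨍ y in F ⁻¹' {c}, W y ∂ρ

section FiberAverage

variable {X κ : Type*} [MeasurableSpace X] {ρ : Measure X} {W : X → ℝ} {F : X → κ}

theorem fiberAverage_mem_Icc [IsFiniteMeasure ρ] (hW : Measurable W)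
    (hW01 : ∀ x, W x ∈ Set.Icc (0 : ℝ) 1) (c : κ) :
    fiberAverage ρ W F c ∈ Set.Icc (0 : ℝ) 1 := by
  have hint : IntegrableOn W (F ⁻¹' {c}) ρ :=
    Integrable.of_bound hW.aestronglyMeasurable 1 <| Eventually.of_forall fun x => by
      rw [Real.norm_eq_abs, abs_of_nonneg (hW01 x).1]
      exact (hW01 x).2
  by_cases h0 : ρ (F ⁻¹' {c}) = 0
  · simp [fiberAverage, Measure.restrict_eq_zero.2 h0]
  · exact (convex_Icc (0 : ℝ) 1).set_average_mem isClosed_Icc h0 (measure_ne_top _ _)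
      (Eventually.of_forall hW01) hint

theorem integrable_comp_of_finite [IsFiniteMeasure ρ] [Finite κ] [MeasurableSpace κ]
    [MeasurableSingletonClass κ] (hF : Measurable F) (h : κ → ℝ) :
    Integrable (fun x => h (F x)) ρ := by
  obtain ⟨C, hC⟩ := (Set.finite_range fun c => ‖h c‖).bddAbove
  exact Integrable.of_bound ((measurable_of_finite h).comp hF).aestronglyMeasurable C
    (Eventually.of_forall fun x => hC ⟨F x, rfl⟩)

theorem integrable_mul_comp_of_finite [IsFiniteMeasure ρ] [Finite κ] [MeasurableSpace κ]
    [MeasurableSingletonClass κ] (hW : Integrable W ρ) (hF : Measurable F) (h : κ → ℝ) :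
    Integrable (fun x => W x * h (F x)) ρ := by
  obtain ⟨C, hC⟩ := (Set.finite_range fun c => ‖h c‖).bddAbove
  exact hW.mul_bdd (c := C) ((measurable_of_finite h).comp hF).aestronglyMeasurable
    (Eventually.of_forall fun x => hC ⟨F x, rfl⟩)

theorem integrable_sub_comp_sq [IsFiniteMeasure ρ] [Finite κ] [MeasurableSpace κ]
    [MeasurableSingletonClass κ] (hW : Integrable W ρ) (hW2 : Integrable (fun x => W x ^ 2) ρ)
    (hF : Measurable F) (h : κ → ℝ) : Integrable (fun x => (W x - h (F x)) ^ 2) ρ := by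
  refine ((hW2.sub ((integrable_mul_comp_of_finite hW hF h).const_mul 2)).add
    (integrable_comp_of_finite hF fun c => h c ^ 2)).congr (Eventually.of_forall fun x => ?_)
  simp only [Pi.add_apply, Pi.sub_apply]
  ring

/-- The deviation of `W` from its fibre averages is orthogonal to functions of `F`. -/
theorem integral_sub_fiberAverage_mul [IsFiniteMeasure ρ] [Fintype κ] [MeasurableSpace κ]
    [MeasurableSingletonClass κ] (hW : Integrable W ρ) (hF : Measurable F) (h : κ → ℝ) :
    ∫ x, (W x - fiberAverage ρ W F (F x)) * h (F x) ∂ρ = 0 := by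
  have hint := integrable_mul_comp_of_finite
    (hW.sub (integrable_comp_of_finite hF (fiberAverage ρ W F))) hF h
  have hcell : ∀ c, MeasurableSet (F ⁻¹' {c}) := fun c => hF (measurableSet_singleton c)
  have hU : (⋃ c, F ⁻¹' {c}) = Set.univ := by ext x; simp
  rw [← setIntegral_univ, ← hU, integral_iUnion_fintype hcell]
  · refine Finset.sum_eq_zero fun c _ => ?_
    have hc : ∫ x in F ⁻¹' {c}, (W x - fiberAverage ρ W F (F x)) * h (F x) ∂ρ
        = ∫ x in F ⁻¹' {c}, (W x - fiberAverage ρ W F c) * h c ∂ρ :=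
      setIntegral_congr_fun (hcell c) fun x hx => by
        have : F x = c := hx
        simp only [this]
    rw [hc, integral_mul_const, integral_sub hW.integrableOn (integrable_const _),
      setIntegral_const, fiberAverage, measure_smul_setAverage _ (measure_ne_top _ _), sub_self,
      zero_mul]
  · intro i j hij
    exact Disjoint.preimage F (by simpa using hij)
  · exact fun c => hint.integrableOn

/-- The fibre averages give the best approximation of `W` in `L²` by a function of `F`. -/
theorem integral_sub_fiberAverage_sq_le [IsFiniteMeasure ρ] [Fintype κ] [MeasurableSpace κ]
    [MeasurableSingletonClass κ] (hW : Integrable W ρ) (hW2 : Integrable (fun x => W x ^ 2) ρ)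
    (hF : Measurable F) (h : κ → ℝ) :
    ∫ x, (W x - fiberAverage ρ W F (F x)) ^ 2 ∂ρ ≤ ∫ x, (W x - h (F x)) ^ 2 ∂ρ := by
  have hsq := integrable_sub_comp_sq hW hW2 hF
  have hcross : Integrable (fun x => (W x - fiberAverage ρ W F (F x)) *
      (2 * (fiberAverage ρ W F (F x) - h (F x)))) ρ := integrable_mul_comp_of_finite
    (hW.sub (integrable_comp_of_finite hF (fiberAverage ρ W F))) hF
    fun c => 2 * (fiberAverage ρ W F c - h c)
  have hzero := integral_sub_fiberAverage_mul hW hF fun c => 2 * (fiberAverage ρ W F c - h c)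
  rw [← add_zero (∫ x, (W x - fiberAverage ρ W F (F x)) ^ 2 ∂ρ), ← hzero]
  rw [← integral_add (hsq _) hcross]
  refine integral_mono ((hsq _).add hcross) (hsq h) fun x => ?_
  nlinarith [sq_nonneg (fiberAverage ρ W F (F x) - h (F x))]

end FiberAverage

section Refinement

variable {Ω ι : Type*} [MeasurableSpace Ω] {μ : Measure Ω} {W : Ω × Ω → ℝ}

theorem fiberAverage_prodMap_symm [SFinite μ] (hsymm : ∀ p, W p.swap = W p) (f : Ω → ι)
    (i j : ι) :
    fiberAverage (μ.prod μ) W (Prod.map f f) (i, j)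
      = fiberAverage (μ.prod μ) W (Prod.map f f) (j, i) := by
  have hmp : MeasurePreserving (MeasurableEquiv.prodComm : Ω × Ω ≃ᵐ Ω × Ω)
      (μ.prod μ) (μ.prod μ) := Measure.measurePreserving_swap
  have hpre : (MeasurableEquiv.prodComm : Ω × Ω ≃ᵐ Ω × Ω) ⁻¹' (Prod.map f f ⁻¹' {(j, i)})
      = Prod.map f f ⁻¹' {(i, j)} := by
    ext ⟨a, b⟩
    simp [MeasurableEquiv.prodComm, and_comm]
  have hint := hmp.setIntegral_preimage_emb (MeasurableEquiv.measurableEmbedding _) W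
    (Prod.map f f ⁻¹' {(j, i)})
  have hmeas := hmp.measure_preimage_equiv (Prod.map f f ⁻¹' {(j, i)})
  rw [hpre] at hint hmeas
  simp only [fiberAverage, setAverage_eq, measureReal_def, hmeas, ← hint]
  congr 2
  funext p
  exact (hsymm p).symm

/-- Refining a partition along `S` and `T` decreases the squared `L²` error of the fibre averages
by at least the square of the integral of the error over `S × T`. -/
theorem integral_sub_fiberAverage_refine_sq_le [IsProbabilityMeasure μ] [Fintype ι]
    [MeasurableSpace ι] [MeasurableSingletonClass ι] (hW : Integrable W (μ.prod μ))
    (hW2 : Integrable (fun p => W p ^ 2) (μ.prod μ)) {f : Ω → ι} (hf : Measurable f)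
    {κ : Type*} [Fintype κ] [MeasurableSpace κ] [MeasurableSingletonClass κ]
    (e : ι × Bool × Bool ≃ κ) {S T : Set Ω} (hS : MeasurableSet S) (hT : MeasurableSet T) :
    ∃ f' : Ω → κ, Measurable f' ∧
      ∫ p, (W p - fiberAverage (μ.prod μ) W (Prod.map f' f') (Prod.map f' f' p)) ^ 2 ∂μ.prod μ
        ≤ ∫ p, (W p - fiberAverage (μ.prod μ) W (Prod.map f f) (Prod.map f f p)) ^ 2 ∂μ.prod μ
          - (∫ p in S ×ˢ T,
              (W p - fiberAverage (μ.prod μ) W (Prod.map f f) (Prod.map f f p)) ∂μ.prod μ) ^ 2 := by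
  set ρ := μ.prod μ
  set A := fiberAverage ρ W (Prod.map f f)
  set D : Ω × Ω → ℝ := fun p => W p - A (Prod.map f f p) with hD
  set I := ∫ p in S ×ˢ T, D p ∂ρ with hI
  have hF : Measurable (Prod.map f f) := hf.prodMap hf
  have hST : MeasurableSet (S ×ˢ T) := hS.prod hT
  let f' : Ω → κ := fun u => e (f u, decide (u ∈ S), decide (u ∈ T))
  have hf' : Measurable f' := by
    refine (measurable_of_finite e).comp (hf.prodMk (Measurable.prodMk ?_ ?_))
    · exact measurable_to_bool (by convert hS using 1; ext; simp)
    · exact measurable_to_bool (by convert hT using 1; ext; simp)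
  refine ⟨f', hf', ?_⟩
  let h : κ × κ → ℝ := fun c =>
    A ((e.symm c.1).1, (e.symm c.2).1) +
      if (e.symm c.1).2.1 = true ∧ (e.symm c.2).2.2 = true then I else 0
  have hh : ∀ p, W p - h (Prod.map f' f' p) = D p - (S ×ˢ T).indicator (fun _ => I) p := by
    intro p
    simp only [h, hD, f', Prod.map, Equiv.symm_apply_apply, decide_eq_true_eq, Set.indicator,
      Set.mem_prod]
    ring
  refine (integral_sub_fiberAverage_sq_le hW hW2 (hf'.prodMap hf') h).trans ?_
  have hDint : Integrable D ρ := hW.sub (integrable_comp_of_finite hF A)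
  have hD2 : Integrable (fun p => D p ^ 2) ρ := integrable_sub_comp_sq hW hW2 hF A
  have hexp : ∀ p, (W p - h (Prod.map f' f' p)) ^ 2
      = D p ^ 2 - (S ×ˢ T).indicator (fun q => 2 * I * D q - I ^ 2) p := by
    intro p
    rw [hh]
    by_cases hp : p ∈ S ×ˢ T
    · simp only [Set.indicator_of_mem hp]; ring
    · simp only [Set.indicator_of_notMem hp]; ring
  have hlin : Integrable (fun q => 2 * I * D q - I ^ 2) ρ :=
    (hDint.const_mul _).sub (integrable_const _)
  simp only [hexp]
  rw [integral_sub hD2 (hlin.indicator hST), integral_indicator hST,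
    integral_sub (hDint.const_mul _).integrableOn (integrable_const _), integral_const_mul,
    setIntegral_const, smul_eq_mul, ← hI]
  have h1 : ρ.real (S ×ˢ T) ≤ 1 := measureReal_le_one
  nlinarith [mul_le_mul_of_nonneg_right h1 (sq_nonneg I)]

end Refinement

theorem four_pow_le_ceil_two_rpow {ε : ℝ} {t : ℕ} (ht : (t : ℝ) ≤ 1 / ε ^ 2) :
    4 ^ t ≤ ⌈(2 : ℝ) ^ ((8 : ℝ) / ε ^ 2)⌉₊ := by
  have h : ((4 ^ t : ℕ) : ℝ) ≤ (2 : ℝ) ^ ((8 : ℝ) / ε ^ 2) := by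
    calc ((4 ^ t : ℕ) : ℝ) = (2 : ℝ) ^ ((2 * t : ℕ) : ℝ) := by
          rw [Real.rpow_natCast, pow_mul]; norm_num
      _ ≤ (2 : ℝ) ^ ((8 : ℝ) / ε ^ 2) := by
          refine Real.rpow_le_rpow_of_exponent_le one_le_two ?_
          have h8 : (8 : ℝ) / ε ^ 2 = 8 * (1 / ε ^ 2) := by ring
          have h0 : (0 : ℝ) ≤ t := t.cast_nonneg
          push_cast
          linarith
  exact_mod_cast h.trans (Nat.le_ceil _)

/-- The step function of averages of `W` over the products of fibres of `f`. -/
def stepAverage {ι : Type*} (W : USq → USq → ℝ) (f : USq → ι) (u v : USq) : ℝ :=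
  fiberAverage (volume.prod volume) (Function.uncurry W) (Prod.map f f) (f u, f v)

theorem IsOrderon.stepAverage {W : USq → USq → ℝ} (hW : IsOrderon W) {ι : Type*} [Finite ι]
    [MeasurableSpace ι] [MeasurableSingletonClass ι] {f : USq → ι} (hf : Measurable f) :
    IsOrderon (stepAverage W f) := by
  refine ⟨?_, fun u v => fiberAverage_mem_Icc hW.1 (fun p => hW.2.1 _ _) _,
    fun u v => fiberAverage_prodMap_symm (fun p => hW.2.2 _ _) f _ _⟩
  exact (measurable_of_finite
    (fiberAverage (volume.prod volume) (Function.uncurry W) (Prod.map f f))).comp (hf.prodMap hf)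

theorem isStepFun_stepAverage (W : USq → USq → ℝ) {k : ℕ} {f : USq → Fin k}
    (hf : Measurable f) : IsStepFun (stepAverage W f) k := by
  refine ⟨fun i => f ⁻¹' {i}, fun i => hf (measurableSet_singleton i), ?_, ?_, ?_⟩
  · intro i j hij
    exact Disjoint.preimage f (by simpa using hij)
  · ext x
    simp
  · rintro i j u rfl v rfl u' hu v' hv
    have hu : f u' = f u := hu
    have hv : f v' = f v := hv
    simp only [stepAverage, hu, hv]

theorem exists_lt_of_lt_cutNorm {D : USq → USq → ℝ} {ε : ℝ} (hε : 0 ≤ ε) (h : ε < cutNorm D) :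
    ∃ S T : Set USq, MeasurableSet S ∧ MeasurableSet T ∧
      ε < |∫ p in S ×ˢ T, D p.1 p.2| := by
  by_contra! hcon
  refine h.not_ge (Real.sSup_le ?_ hε)
  rintro x ⟨S, T, hS, hT, rfl⟩
  exact hcon S T hS hT

/-- Weak regularity: every orderon is `ε`-approximated in cut norm by a step-function
orderon with at most `⌈2^{8/ε²}⌉` steps. -/
theorem step_function_approximation (W : USq → USq → ℝ) (hW : IsOrderon W)
    (ε : ℝ) (hε : 0 < ε) :
    ∃ k : ℕ, k ≤ ⌈(2:ℝ) ^ ((8:ℝ) / ε^2)⌉₊ ∧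
      ∃ U : USq → USq → ℝ, IsOrderon U ∧ IsStepFun U k ∧
        cutNorm (fun u v => W u v - U u v) ≤ ε := by
  by_contra! hcon
  have hW01 : ∀ p, Function.uncurry W p ∈ Set.Icc (0 : ℝ) 1 := fun p => hW.2.1 _ _
  have hWint : Integrable (Function.uncurry W) ((volume : Measure USq).prod volume) :=
    Integrable.of_bound hW.1.aestronglyMeasurable 1 <| Eventually.of_forall fun p => by
      rw [Real.norm_eq_abs, abs_le]
      constructor <;> linarith [(hW01 p).1, (hW01 p).2]
  have hW2int : Integrable (fun p => Function.uncurry W p ^ 2)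
      ((volume : Measure USq).prod volume) :=
    Integrable.of_bound (hW.1.pow_const 2).aestronglyMeasurable 1 <|
      Eventually.of_forall fun p => by
        rw [Real.norm_eq_abs, abs_le]
        constructor <;> nlinarith [(hW01 p).1, (hW01 p).2]
  have key : ∀ t : ℕ, t ≤ ⌊1 / ε ^ 2⌋₊ + 1 → ∃ f : USq → Fin (4 ^ t), Measurable f ∧
      ∫ p : USq × USq, (W p.1 p.2 - stepAverage W f p.1 p.2) ^ 2 ∂volume.prod volume
        ≤ 1 - t * ε ^ 2 := by
    intro t
    induction t with
    | zero =>
      refine fun _ => ⟨fun _ => 0, measurable_const, ?_⟩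
      have hA := hW.stepAverage (f := fun _ : USq => (0 : Fin (4 ^ 0))) measurable_const
      refine (integral_mono_of_nonneg (Eventually.of_forall fun p => sq_nonneg _)
        (integrable_const (1 : ℝ)) (Eventually.of_forall fun p => ?_)).trans (by simp)
      have h1 := hW.2.1 p.1 p.2
      have h2 := hA.2.1 p.1 p.2
      refine (sq_le_one_iff_abs_le_one _).2 (abs_le.2 ⟨?_, ?_⟩) <;>
        linarith [h1.1, h1.2, h2.1, h2.2]
    | succ t ih =>
      intro ht
      obtain ⟨f, hf, hle⟩ := ih (by omega)
      have ht' : (t : ℝ) ≤ 1 / ε ^ 2 := (Nat.le_floor_iff (by positivity)).1 (by omega)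
      obtain ⟨S, T, hS, hT, hlt⟩ := exists_lt_of_lt_cutNorm hε.le
        (hcon _ (four_pow_le_ceil_two_rpow ht') _ (hW.stepAverage hf)
          (isStepFun_stepAverage W hf))
      have hcard : Fintype.card (Fin (4 ^ t) × Bool × Bool) = 4 ^ (t + 1) := by
        simp [pow_succ]
      obtain ⟨f', hf', hle'⟩ := integral_sub_fiberAverage_refine_sq_le hWint hW2int hf
        (Fintype.equivFinOfCardEq hcard) hS hT
      refine ⟨f', hf', hle'.trans ((sub_le_sub hle (sq_le_sq' ?_ hlt.le |>.trans_eq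
        (sq_abs _))).trans_eq ?_)⟩
      · linarith [abs_nonneg (∫ p in S ×ˢ T, W p.1 p.2 - stepAverage W f p.1 p.2)]
      · push_cast
        ring
  obtain ⟨f, -, hle⟩ := key _ le_rfl
  have h0 : 0 ≤ ∫ p : USq × USq, (W p.1 p.2 - stepAverage W f p.1 p.2) ^ 2 ∂volume.prod volume :=
    integral_nonneg fun p => sq_nonneg _
  have hfl : 1 / ε ^ 2 < ((⌊1 / ε ^ 2⌋₊ + 1 : ℕ) : ℝ) := by
    push_cast
    exact Nat.lt_floor_add_one _
  rw [div_lt_iff₀ (by positivity)] at hfl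
  linarith
end
end

section
/- For every orderon W and every ε > 0 there is a partition 𝒫 of [0,1]^2 into at most 2^{⌈32/ε²⌉} measurable sets of positive Lebesgue measure such that ‖W − W_𝒫‖_□ ≤ ε. -/
open MeasureTheory Real Filter
open scoped ENNReal Classical

noncomputable section

/-- The stepping `W_𝒫` of `W` with respect to a partition `S 0, …, S (k-1)` of `[0,1]²`:
on `S i × S j` it takes the value `(1/(λ(S i)·λ(S j)))·∫_{S i × S j} W`. -/
def stepping (W : USq → USq → ℝ) {k : ℕ} (S : Fin k → Set USq) : USq → USq → ℝ :=
  fun u v => ∑ i : Fin k, ∑ j : Fin k,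
    (S i).indicator (fun _ => (1:ℝ)) u * (S j).indicator (fun _ => (1:ℝ)) v *
      (((volume (S i)).toReal * (volume (S j)).toReal)⁻¹ * ∫ p in (S i) ×ˢ (S j), W p.1 p.2)

/-- The index map sending a pair of points to the pair of cells containing them. -/
def cellPair {ι : Type*} (f : USq → ι) (p : USq × USq) : ι × ι := (f p.1, f p.2)

lemma measurable_cellPair {k : ℕ} {f : USq → Fin k} (hf : Measurable f) :
    Measurable (cellPair f) :=
  (hf.comp measurable_fst).prodMk (hf.comp measurable_snd)

lemma stepping_fibers_eq (W : USq → USq → ℝ) {k : ℕ} (f : USq → Fin k) (u v : USq) :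
    stepping W (fun i => f ⁻¹' {i}) u v =
      ((volume (f ⁻¹' {f u})).toReal * (volume (f ⁻¹' {f v})).toReal)⁻¹ *
        ∫ p in (f ⁻¹' {f u}) ×ˢ (f ⁻¹' {f v}), W p.1 p.2 := by
  unfold stepping
  rw [Finset.sum_eq_single (f u), Finset.sum_eq_single (f v)]
  · simp
  · intro j _ hj
    simp [Set.indicator, Ne.symm hj]
  · simp
  · intro i _ hi
    simp [Set.indicator, Ne.symm hi]
  · simp

lemma integrable_of_measurable_of_bound {g : USq × USq → ℝ} (hg : Measurable g)
    (h : ∃ C, ∀ p, |g p| ≤ C) : Integrable g := by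
  obtain ⟨C, hC⟩ := h
  exact Integrable.of_bound hg.aestronglyMeasurable C (ae_of_all _ hC)

lemma exists_bound_comp {α ι : Type*} [Finite ι] (φ : ι → ℝ) (F : α → ι) :
    ∃ C, ∀ p, |φ (F p)| ≤ C := by
  obtain ⟨C, hC⟩ := (Set.finite_range fun i => |φ i|).bddAbove
  exact ⟨C, fun p => hC ⟨F p, rfl⟩⟩

lemma exists_bound_mul {α : Type*} {g h : α → ℝ} (hg : ∃ C, ∀ p, |g p| ≤ C)
    (hh : ∃ C, ∀ p, |h p| ≤ C) : ∃ C, ∀ p, |g p * h p| ≤ C := by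
  obtain ⟨C, hC⟩ := hg
  obtain ⟨D, hD⟩ := hh
  refine ⟨C * D, fun p => ?_⟩
  rw [abs_mul]
  exact mul_le_mul (hC p) (hD p) (abs_nonneg _) ((abs_nonneg _).trans (hC p))

lemma exists_bound_sub {α : Type*} {g h : α → ℝ} (hg : ∃ C, ∀ p, |g p| ≤ C)
    (hh : ∃ C, ∀ p, |h p| ≤ C) : ∃ C, ∀ p, |g p - h p| ≤ C := by
  obtain ⟨C, hC⟩ := hg
  obtain ⟨D, hD⟩ := hh
  exact ⟨C + D, fun p => (abs_sub _ _).trans (add_le_add (hC p) (hD p))⟩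

lemma IsOrderon.measurable_pair {W : USq → USq → ℝ} (hW : IsOrderon W) :
    Measurable fun p : USq × USq => W p.1 p.2 := hW.1

lemma IsOrderon.exists_bound {W : USq → USq → ℝ} (hW : IsOrderon W) :
    ∃ C, ∀ p : USq × USq, |W p.1 p.2| ≤ C :=
  ⟨1, fun p => abs_le.2 ⟨by linarith [(hW.2.1 p.1 p.2).1], (hW.2.1 p.1 p.2).2⟩⟩

lemma exists_stepping_fibers_eq_comp (W : USq → USq → ℝ) {k : ℕ} (f : USq → Fin k) :
    ∃ A : Fin k × Fin k → ℝ, (∀ p : USq × USq,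
      stepping W (fun i => f ⁻¹' {i}) p.1 p.2 = A (cellPair f p)) ∧
      ∀ c, A c = ((volume (f ⁻¹' {c.1})).toReal * (volume (f ⁻¹' {c.2})).toReal)⁻¹ *
        ∫ p in (f ⁻¹' {c.1}) ×ˢ (f ⁻¹' {c.2}), W p.1 p.2 :=
  ⟨_, fun p => stepping_fibers_eq W f p.1 p.2, fun _ => rfl⟩

lemma integral_sub_stepping_mul_eq_zero {W : USq → USq → ℝ} (hW : IsOrderon W) {k : ℕ}
    {f : USq → Fin k} (hf : Measurable f) (hpos : ∀ i, 0 < volume (f ⁻¹' {i}))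
    (φ : Fin k × Fin k → ℝ) :
    ∫ p : USq × USq, (W p.1 p.2 - stepping W (fun i => f ⁻¹' {i}) p.1 p.2) *
      φ (cellPair f p) = 0 := by
  obtain ⟨A, hA, hA'⟩ := exists_stepping_fibers_eq_comp W f
  simp_rw [hA]
  have hF := measurable_cellPair hf
  have hWi : Integrable fun p : USq × USq => W p.1 p.2 :=
    integrable_of_measurable_of_bound hW.measurable_pair hW.exists_bound
  have hAi : Integrable fun p : USq × USq => A (cellPair f p) :=
    integrable_of_measurable_of_bound ((measurable_of_finite A).comp hF)
      (exists_bound_comp A _)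
  have hcell : ∀ c, MeasurableSet (cellPair f ⁻¹' {c}) := fun c => hF (measurableSet_singleton c)
  have hsum : ∀ p : USq × USq, (W p.1 p.2 - A (cellPair f p)) * φ (cellPair f p) =
      ∑ c, φ c * (cellPair f ⁻¹' {c}).indicator
        (fun p : USq × USq => W p.1 p.2 - A (cellPair f p)) p := by
    intro p
    rw [Finset.sum_eq_single (cellPair f p)]
    · simp [mul_comm]
    · intro c _ hc
      simp [Set.indicator, Ne.symm hc]
    · simp
  simp_rw [hsum]
  have hWAi : Integrable fun p : USq × USq => W p.1 p.2 - A (cellPair f p) := hWi.sub hAi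
  rw [integral_finsetSum _ fun c _ => (hWAi.indicator (hcell c)).const_mul _]
  refine Finset.sum_eq_zero fun c _ => ?_
  rw [integral_const_mul, integral_indicator (hcell c),
    integral_sub hWi.integrableOn hAi.integrableOn,
    setIntegral_congr_fun (g := fun _ => A c) (hcell c) fun p hp => congrArg A hp,
    setIntegral_const]
  have hprod : cellPair f ⁻¹' {c} = (f ⁻¹' {c.1}) ×ˢ (f ⁻¹' {c.2}) := by
    ext p
    simp [cellPair, Prod.ext_iff]
  have h1 : (volume (f ⁻¹' {c.1})).toReal ≠ 0 :=
    (ENNReal.toReal_pos (hpos _).ne' (measure_ne_top _ _)).ne'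
  have h2 : (volume (f ⁻¹' {c.2})).toReal ≠ 0 :=
    (ENNReal.toReal_pos (hpos _).ne' (measure_ne_top _ _)).ne'
  rw [hprod, hA', Measure.real, Measure.volume_eq_prod USq USq, Measure.prod_prod,
    ENNReal.toReal_mul, smul_eq_mul, mul_inv_cancel_left₀ (mul_ne_zero h1 h2), sub_self, mul_zero]

/-- The stepping minimises the `L²` distance to `W` among functions constant on the cells. -/
lemma integral_sub_stepping_sq_le {W : USq → USq → ℝ} (hW : IsOrderon W) {k : ℕ}
    {f : USq → Fin k} (hf : Measurable f) (hpos : ∀ i, 0 < volume (f ⁻¹' {i}))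
    (φ : Fin k × Fin k → ℝ) :
    ∫ p : USq × USq, (W p.1 p.2 - stepping W (fun i => f ⁻¹' {i}) p.1 p.2) ^ 2 ≤
      ∫ p : USq × USq, (W p.1 p.2 - φ (cellPair f p)) ^ 2 := by
  obtain ⟨A, hA, -⟩ := exists_stepping_fibers_eq_comp W f
  have horth := integral_sub_stepping_mul_eq_zero hW hf hpos fun c => 2 * (A c - φ c)
  simp_rw [hA] at horth ⊢
  have hF := measurable_cellPair hf
  have hm : ∀ ψ : Fin k × Fin k → ℝ, Measurable fun p => ψ (cellPair f p) :=
    fun ψ => (measurable_of_finite ψ).comp hF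
  have hd : ∀ ψ : Fin k × Fin k → ℝ,
      Measurable fun p : USq × USq => W p.1 p.2 - ψ (cellPair f p) :=
    fun ψ => hW.measurable_pair.sub (hm ψ)
  have hb : ∀ ψ : Fin k × Fin k → ℝ,
      ∃ C, ∀ p : USq × USq, |W p.1 p.2 - ψ (cellPair f p)| ≤ C :=
    fun ψ => exists_bound_sub hW.exists_bound (exists_bound_comp ψ _)
  have hsq : ∀ ψ : Fin k × Fin k → ℝ,
      Integrable fun p : USq × USq => (W p.1 p.2 - ψ (cellPair f p)) ^ 2 := by
    intro ψ
    simp_rw [sq]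
    exact integrable_of_measurable_of_bound ((hd ψ).mul (hd ψ)) (exists_bound_mul (hb ψ) (hb ψ))
  have hcross : Integrable fun p : USq × USq =>
      (W p.1 p.2 - A (cellPair f p)) * (2 * (A (cellPair f p) - φ (cellPair f p))) :=
    integrable_of_measurable_of_bound ((hd A).mul (hm fun c => 2 * (A c - φ c)))
      (exists_bound_mul (hb A) (exists_bound_comp (fun c => 2 * (A c - φ c)) _))
  rw [← add_zero (∫ p : USq × USq, (W p.1 p.2 - A (cellPair f p)) ^ 2), ← horth,
    ← integral_add (hsq A) hcross]
  refine integral_mono ((hsq A).add hcross) (hsq φ) fun p => ?_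
  dsimp only
  nlinarith [sq_nonneg (A (cellPair f p) - φ (cellPair f p))]

/-- Up to a null set, a finite measurable labelling factors through one all of whose fibers have
positive measure. -/
lemma exists_map_pos_fibers {ι : Type*} [Fintype ι] [MeasurableSpace ι]
    [MeasurableSingletonClass ι] {g : USq → ι} (hg : Measurable g) :
    ∃ k ≤ Fintype.card ι, ∃ (f : USq → Fin k) (e : Fin k → ι), Measurable f ∧
      (∀ i, 0 < volume (f ⁻¹' {i})) ∧ ∀ᵐ u, e (f u) = g u := by
  let J := {i : ι // 0 < volume (g ⁻¹' {i})}
  have hae : ∀ᵐ u, 0 < volume (g ⁻¹' {g u}) := by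
    have : ∀ i, ∀ᵐ u, g u = i → 0 < volume (g ⁻¹' {i}) := by
      intro i
      by_cases hi : 0 < volume (g ⁻¹' {i})
      · exact ae_of_all _ fun _ _ => hi
      · have h0 : volume (g ⁻¹' {i}) = 0 := by simpa using hi
        filter_upwards [measure_eq_zero_iff_ae_notMem.1 h0] with u hu hui
        exact absurd hui hu
    filter_upwards [ae_all_iff.2 this] with u hu using hu _ rfl
  obtain ⟨u₀, hu₀⟩ := hae.exists
  let q : ι → J := fun i => if h : 0 < volume (g ⁻¹' {i}) then ⟨i, h⟩ else ⟨g u₀, hu₀⟩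
  let E := Fintype.equivFin J
  refine ⟨Fintype.card J, Fintype.card_subtype_le _, fun u => E (q (g u)),
    fun i => (E.symm i).1, (measurable_of_finite fun i => E (q i)).comp hg, fun i => ?_, ?_⟩
  · refine (E.symm i).2.trans_le (measure_mono fun u hu => ?_)
    have hu' : g u = (E.symm i).1 := hu
    have : q (g u) = E.symm i := by
      rw [hu']
      exact dif_pos (E.symm i).2
    simp [this]
  · filter_upwards [hae] with u hu
    simp [q, hu]

/-- If the stepping is far from `W` in cut norm, some refinement of the partition into at most
four times as many cells is closer to `W` in `L²`. -/
lemma exists_refinement_of_lt_cutNorm {W : USq → USq → ℝ} (hW : IsOrderon W) {ε : ℝ}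
    (hε : 0 < ε) {k : ℕ} {f : USq → Fin k} (hf : Measurable f)
    (hcut : ε < cutNorm fun u v => W u v - stepping W (fun i => f ⁻¹' {i}) u v) :
    ∃ l ≤ 4 * k, ∃ g : USq → Fin l, Measurable g ∧ (∀ i, 0 < volume (g ⁻¹' {i})) ∧
      ∫ p : USq × USq, (W p.1 p.2 - stepping W (fun i => g ⁻¹' {i}) p.1 p.2) ^ 2 ≤
        (∫ p : USq × USq, (W p.1 p.2 - stepping W (fun i => f ⁻¹' {i}) p.1 p.2) ^ 2) - ε ^ 2 := by
  unfold cutNorm at hcut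
  obtain ⟨_, ⟨S, T, hS, hT, rfl⟩, hlt⟩ :=
    exists_lt_of_lt_csSup (by exact ⟨_, ∅, ∅, .empty, .empty, rfl⟩) hcut
  obtain ⟨A, hA, -⟩ := exists_stepping_fibers_eq_comp W f
  simp_rw [hA]
  simp only [fun p : USq × USq => hA p] at hlt
  set c := ∫ p in S ×ˢ T, (W p.1 p.2 - A (cellPair f p)) with hc
  have hmem : ∀ {s : Set USq}, MeasurableSet s → Measurable fun u => decide (u ∈ s) :=
    fun hs => measurable_to_bool (by simpa [Set.preimage] using hs)
  obtain ⟨l, hl, g, e, hg, hgpos, hge⟩ := exists_map_pos_fibers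
    (g := fun u => (f u, decide (u ∈ S), decide (u ∈ T)))
    (hf.prodMk ((hmem hS).prodMk (hmem hT)))
  refine ⟨l, hl.trans (by simp; omega), g, hg, hgpos, ?_⟩
  let φ : (Fin k × Bool × Bool) × (Fin k × Bool × Bool) → ℝ := fun x =>
    A (x.1.1, x.2.1) + if x.1.2.1 ∧ x.2.2.2 then c else 0
  have hF := measurable_cellPair hf
  have hST : MeasurableSet (S ×ˢ T) := hS.prod hT
  have hd : Measurable fun p : USq × USq => W p.1 p.2 - A (cellPair f p) :=
    hW.measurable_pair.sub ((measurable_of_finite A).comp hF)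
  have hb : ∃ C, ∀ p : USq × USq, |W p.1 p.2 - A (cellPair f p)| ≤ C :=
    exists_bound_sub hW.exists_bound (exists_bound_comp A _)
  have hi : Integrable fun p : USq × USq => W p.1 p.2 - A (cellPair f p) :=
    integrable_of_measurable_of_bound hd hb
  have hsq : Integrable fun p : USq × USq => (W p.1 p.2 - A (cellPair f p)) ^ 2 := by
    simp_rw [sq]
    exact integrable_of_measurable_of_bound (hd.mul hd) (exists_bound_mul hb hb)
  have hi' : Integrable fun p : USq × USq =>
      c ^ 2 - 2 * c * (W p.1 p.2 - A (cellPair f p)) :=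
    (integrable_const _).sub (hi.const_mul _)
  calc ∫ p : USq × USq, (W p.1 p.2 - stepping W (fun i => g ⁻¹' {i}) p.1 p.2) ^ 2
      ≤ ∫ p : USq × USq, (W p.1 p.2 - φ (e (g p.1), e (g p.2))) ^ 2 :=
        integral_sub_stepping_sq_le hW hg hgpos fun x => φ (e x.1, e x.2)
    _ = ∫ p : USq × USq, ((W p.1 p.2 - A (cellPair f p)) ^ 2 + (S ×ˢ T).indicator
          (fun p : USq × USq => c ^ 2 - 2 * c * (W p.1 p.2 - A (cellPair f p))) p) := by
        refine integral_congr_ae ?_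
        have h1 := Measure.quasiMeasurePreserving_fst (μ := (volume : Measure USq))
          (ν := (volume : Measure USq)) |>.ae hge
        have h2 := Measure.quasiMeasurePreserving_snd (μ := (volume : Measure USq))
          (ν := (volume : Measure USq)) |>.ae hge
        rw [← Measure.volume_eq_prod] at h1 h2
        filter_upwards [h1, h2] with p hp1 hp2
        rw [hp1, hp2]
        by_cases hp : p ∈ S ×ˢ T
        · have hp' : p.1 ∈ S ∧ p.2 ∈ T := hp
          simp only [Set.indicator_of_mem hp, φ, hp', decide_true, and_self, if_true, cellPair]
          ring
        · have hp' : ¬ (p.1 ∈ S ∧ p.2 ∈ T) := hp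
          simp only [Set.indicator_of_notMem hp, φ, decide_eq_true_eq, hp', if_false, cellPair,
            add_zero]
    _ = (∫ p : USq × USq, (W p.1 p.2 - A (cellPair f p)) ^ 2) +
          (volume.real (S ×ˢ T) * c ^ 2 - 2 * c * c) := by
        rw [integral_add hsq (hi'.indicator hST), integral_indicator hST,
          integral_sub (integrable_const _) (hi.const_mul _).integrableOn, setIntegral_const,
          integral_const_mul, ← hc, smul_eq_mul]
    _ ≤ _ := by
        have hv : volume.real (S ×ˢ T) ≤ 1 := measureReal_le_one
        have hcε : ε ^ 2 ≤ c ^ 2 := by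
          rw [← sq_abs c]
          exact pow_le_pow_left₀ hε.le hlt.le 2
        nlinarith [mul_le_mul_of_nonneg_right hv (sq_nonneg c)]

/-- For every orderon `W` and `ε > 0` there is a partition of `[0,1]²` into at most
`2^{⌈32/ε²⌉}` measurable sets of positive measure with `‖W - W_𝒫‖_□ ≤ ε`. -/
theorem stepping_approximation (W : USq → USq → ℝ) (hW : IsOrderon W)
    (ε : ℝ) (hε : 0 < ε) :
    ∃ k : ℕ, k ≤ 2 ^ (⌈(32:ℝ) / ε^2⌉₊) ∧
      ∃ S : Fin k → Set USq, (∀ i, MeasurableSet (S i)) ∧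
        Pairwise (Function.onFun Disjoint S) ∧ (⋃ i, S i) = Set.univ ∧
        (∀ i, 0 < volume (S i)) ∧
        cutNorm (fun u v => W u v - stepping W S u v) ≤ ε := by
  by_contra hcon
  set M := ⌈(32:ℝ) / ε^2⌉₊ with hM
  have hlt : ∀ {k : ℕ} {f : USq → Fin k}, k ≤ 2 ^ M → Measurable f →
      (∀ i, 0 < volume (f ⁻¹' {i})) →
      ε < cutNorm fun u v => W u v - stepping W (fun i => f ⁻¹' {i}) u v := by
    intro k f hk hf hpos
    by_contra! h
    refine hcon ⟨k, hk, fun i => f ⁻¹' {i}, fun i => hf (measurableSet_singleton i),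
      fun i j hij => ?_, ?_, hpos, h⟩
    · exact Disjoint.preimage f (Set.disjoint_singleton.2 hij)
    · ext u
      simp
  have key : ∀ n : ℕ, 2 * n ≤ M + 2 → ∃ k ≤ 4 ^ n, ∃ f : USq → Fin k, Measurable f ∧
      (∀ i, 0 < volume (f ⁻¹' {i})) ∧
      ∫ p : USq × USq, (W p.1 p.2 - stepping W (fun i => f ⁻¹' {i}) p.1 p.2) ^ 2 ≤
        1 - n * ε ^ 2 := by
    intro n
    induction n with
    | zero =>
      intro _
      have hpos : ∀ i : Fin 1, 0 < volume ((fun _ : USq => (0 : Fin 1)) ⁻¹' {i}) := by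
        intro i
        simp [Subsingleton.elim i 0]
      refine ⟨1, le_rfl, fun _ => 0, measurable_const, hpos, ?_⟩
      refine (integral_sub_stepping_sq_le hW measurable_const hpos fun _ => 0).trans ?_
      calc ∫ p : USq × USq, (W p.1 p.2 - 0) ^ 2 ≤ ∫ _ : USq × USq, (1 : ℝ) := by
            refine integral_mono_of_nonneg (ae_of_all _ fun p => sq_nonneg _)
              (integrable_const _) (ae_of_all _ fun p => ?_)
            have := hW.2.1 p.1 p.2
            simpa only [sub_zero] using pow_le_one₀ this.1 this.2
        _ ≤ 1 - ((0 : ℕ) : ℝ) * ε ^ 2 := by simp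
    | succ n ih =>
      intro hn
      obtain ⟨k, hk, f, hf, hpos, hD⟩ := ih (by omega)
      have hkM : k ≤ 2 ^ M := by
        refine hk.trans ?_
        rw [show 4 = 2 ^ 2 from rfl, ← pow_mul]
        exact Nat.pow_le_pow_right two_pos (by omega)
      obtain ⟨l, hl, g, hg, hgpos, hgD⟩ :=
        exists_refinement_of_lt_cutNorm hW hε hf (hlt hkM hf hpos)
      refine ⟨l, hl.trans (by rw [pow_succ]; omega), g, hg, hgpos, hgD.trans ?_⟩
      push_cast
      linarith
  obtain ⟨k, -, f, -, -, hD⟩ := key (M / 2 + 1) (by omega)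
  have h0 := (integral_nonneg fun p : USq × USq =>
    sq_nonneg (W p.1 p.2 - stepping W (fun i => f ⁻¹' {i}) p.1 p.2)).trans hD
  have h32 : 32 ≤ (M : ℝ) * ε ^ 2 := (div_le_iff₀ (by positivity)).1 (Nat.le_ceil _)
  have hMn : (M : ℝ) ≤ 2 * ((M / 2 + 1 : ℕ) : ℝ) := by
    exact_mod_cast (by omega : M ≤ 2 * (M / 2 + 1))
  nlinarith [mul_le_mul_of_nonneg_right hMn (sq_nonneg ε)]
end
end

section
/- Fix ε > 0. Let 𝒫 be an equipartition of [0,1]^2 into k measurable sets, and let q ≥ 2k²·2^{162/ε²} be an integer divisible by k. Then for any orderon W there exists an equipartition 𝒬 of [0,1]^2 into q sets which refines 𝒫 and satisfies ‖W − W_𝒬‖_□ ≤ 8ε/9 + 2/k. -/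
open MeasureTheory Real Filter
open scoped ENNReal Classical

noncomputable section

theorem exists_measurableSet_subset_volume_real_eq {A : Set USq} (hA : MeasurableSet A) {r : ℝ}
    (h0 : 0 ≤ r) (hr : r ≤ volume.real A) :
    ∃ B ⊆ A, MeasurableSet B ∧ volume.real B = r := by
  have hm : ∀ t : UI, MeasurableSet {u : USq | u.1 ≤ t} := fun t =>
    measurableSet_le measurable_fst measurable_const
  let f : UI → ℝ := fun t => volume.real (A ∩ {u : USq | u.1 ≤ t})
  have hstrip : ∀ x y : UI, x ≤ y → volume.real {u : USq | x < u.1 ∧ u.1 ≤ y} = (y - x : ℝ) := by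
    intro x y h
    have : {u : USq | x < u.1 ∧ u.1 ≤ y} = Set.Ioc x y ×ˢ Set.univ := by ext; simp
    rw [this, Measure.volume_eq_prod, measureReal_prod_prod]
    simp [measureReal_def, h]
  have hmono : Monotone f := fun x y h =>
    measureReal_mono (Set.inter_subset_inter_right _ fun u hu => le_trans hu h)
  have hinc : ∀ x y : UI, x ≤ y → f y - f x ≤ y - x := by
    intro x y h
    have : f y ≤ volume.real ((A ∩ {u : USq | u.1 ≤ x}) ∪ {u : USq | x < u.1 ∧ u.1 ≤ y}) := by
      refine measureReal_mono fun u hu => ?_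
      rcases le_or_gt u.1 x with h' | h'
      · exact Or.inl ⟨hu.1, h'⟩
      · exact Or.inr ⟨h', hu.2⟩
    have h2 := this.trans (measureReal_union_le _ _)
    rw [hstrip x y h] at h2
    change f y ≤ f x + _ at h2
    linarith
  have hlip : LipschitzWith 1 f := by
    refine LipschitzWith.of_dist_le_mul fun x y => ?_
    rw [NNReal.coe_one, one_mul, Subtype.dist_eq, Real.dist_eq, Real.dist_eq]
    rcases le_total x y with h | h
    · rw [abs_sub_comm, abs_sub_comm (x : ℝ), abs_of_nonneg (sub_nonneg.2 (hmono h))]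
      exact (hinc x y h).trans (le_abs_self _)
    · rw [abs_of_nonneg (sub_nonneg.2 (hmono h))]
      exact (hinc y x h).trans (le_abs_self _)
  have hf0 : f 0 = 0 := by
    have h1 : {u : USq | u.1 ≤ 0} = {0} ×ˢ Set.univ := by
      ext u
      simp only [Set.mem_ofPred_eq, Set.mem_prod, Set.mem_singleton_iff, Set.mem_univ, and_true]
      exact ⟨fun h => le_antisymm h u.1.2.1, fun h => h.le⟩
    have h2 : volume.real {u : USq | u.1 ≤ 0} = 0 := by
      rw [h1, Measure.volume_eq_prod, measureReal_prod_prod]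
      simp [measureReal_def]
    exact le_antisymm (h2 ▸ measureReal_mono Set.inter_subset_right) measureReal_nonneg
  have hf1 : f 1 = volume.real A := by
    have : A ∩ {u : USq | u.1 ≤ 1} = A := Set.inter_eq_left.2 fun u _ => u.1.2.2
    simp only [f, this]
  obtain ⟨t, ht⟩ := mem_range_of_exists_le_of_exists_ge hlip.continuous
    ⟨0, hf0.trans_le h0⟩ ⟨1, hr.trans_eq hf1.symm⟩
  exact ⟨_, Set.inter_subset_left, hA.inter (hm t), ht⟩

/-- A set of measure `(N + 1) * δ` can be cut into `N + 1` pieces of measure `δ` in such a way that at most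
`m` pieces meet more than one cell of a given partition into `m` cells. -/
theorem exists_equipartition_subordinate {m : ℕ} {c : USq → Fin m} (hc : Measurable c) {δ : ℝ}
    (hδ : 0 < δ) (N : ℕ) {A : Set USq} (hA : MeasurableSet A) (hAδ : volume.real A = (N + 1) * δ) :
    ∃ (Q : Fin (N + 1) → Set USq) (B : Finset (Fin (N + 1))), (∀ j, MeasurableSet (Q j)) ∧
      Pairwise (Function.onFun Disjoint Q) ∧ (⋃ j, Q j) = A ∧
      (∀ j, volume.real (Q j) = δ) ∧ B.card ≤ m ∧ ∀ j ∉ B, ∃ l, Q j ⊆ c ⁻¹' {l} := by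
  induction N generalizing A with
  | zero =>
    have hm : 1 ≤ m := Fin.pos (c 0)
    exact ⟨fun _ => A, Finset.univ, fun _ => hA, fun i j hij => absurd (Fin.ext (by omega)) hij,
      Set.iUnion_const A, fun _ => by simpa using hAδ, by simpa using hm, by simp⟩
  | succ N ih =>
    push_cast at hAδ
    have hNδ : 0 ≤ N * δ := by positivity
    obtain ⟨X, hXA, hXm, hX, hXc⟩ : ∃ X ⊆ A, MeasurableSet X ∧ volume.real X = δ ∧
        (m < N + 2 → ∃ l, X ⊆ c ⁻¹' {l}) := by
      by_cases hm : m < N + 2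
      · obtain ⟨l, hl⟩ : ∃ l, δ ≤ volume.real (A ∩ c ⁻¹' {l}) := by
          by_contra! h
          have h1 : A = ⋃ l ∈ (Finset.univ : Finset (Fin m)), A ∩ c ⁻¹' {l} := by
            ext u; simp
          have h2 : volume.real A ≤ ∑ l : Fin m, volume.real (A ∩ c ⁻¹' {l}) := by
            conv_lhs => rw [h1]
            exact measureReal_biUnion_finset_le _ _
          have h3 : ∑ l : Fin m, volume.real (A ∩ c ⁻¹' {l}) ≤ ∑ _l : Fin m, δ :=
            Finset.sum_le_sum fun l _ => (h l).le
          rw [Finset.sum_const, Finset.card_univ, Fintype.card_fin, nsmul_eq_mul] at h3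
          have h4 : (m : ℝ) ≤ N + 1 := by exact_mod_cast Nat.lt_succ_iff.1 hm
          nlinarith
        obtain ⟨X, hX1, hX2, hX3⟩ := exists_measurableSet_subset_volume_real_eq
          (hA.inter (hc (measurableSet_singleton l))) hδ.le hl
        exact ⟨X, hX1.trans Set.inter_subset_left, hX2, hX3,
          fun _ => ⟨l, hX1.trans Set.inter_subset_right⟩⟩
      · obtain ⟨X, hX1, hX2, hX3⟩ := exists_measurableSet_subset_volume_real_eq hA hδ.le
          (by linarith : δ ≤ volume.real A)
        exact ⟨X, hX1, hX2, hX3, fun h => absurd h hm⟩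
    obtain ⟨Q, B, hQm, hQd, hQu, hQδ, hB, hQc⟩ := ih (hA.diff hXm) (by
      rw [measureReal_sdiff hXA hXm, hAδ, hX]; ring)
    have hQA : ∀ j, Q j ⊆ A \ X := fun j => hQu ▸ Set.subset_iUnion Q j
    refine ⟨Fin.cons X Q, if m < N + 2 then B.map (Fin.succEmb (N + 1)) else Finset.univ,
      Fin.cases hXm hQm, ?_, ?_,
      Fin.cases hX hQδ, ?_, ?_⟩
    · have h0 : ∀ j, Disjoint X (Q j) := fun j => Set.disjoint_left.2 fun u hu hu' => (hQA j hu').2 hu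
      intro i j
      refine Fin.cases ?_ (fun i => ?_) i <;> refine Fin.cases ?_ (fun j => ?_) j <;> intro hij
      · exact absurd rfl hij
      · exact h0 j
      · exact (h0 i).symm
      · exact hQd fun h => hij (congrArg Fin.succ h)
    · ext u
      rw [Set.mem_iUnion, Fin.exists_fin_succ]
      simp only [Fin.cons_zero, Fin.cons_succ]
      rw [← Set.mem_iUnion, hQu, ← Set.mem_union, Set.union_sdiff_cancel hXA]
    · split_ifs with h
      · simpa using hB
      · rw [Finset.card_univ, Fintype.card_fin]; exact not_lt.1 h
    · intro j
      split_ifs with h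
      · refine Fin.cases (fun _ => hXc h) (fun j hj => ?_) j
        exact hQc j fun hjB => hj (Finset.mem_map_of_mem _ hjB)
      · simp

/-- Cut-norm regularity: a bounded kernel is within `δ` in cut norm of a step function with at most
`4 ^ N` steps, as soon as `1 < (N + 1) * δ ^ 2`. -/
theorem exists_step_approx {W : USq → USq → ℝ} (hWm : Measurable (Function.uncurry W))
    (hW : ∀ u v, W u v ∈ Set.Icc (0 : ℝ) 1) {δ : ℝ} (hδ : 0 < δ) {N : ℕ}
    (hN : 1 < (N + 1) * δ ^ 2) :
    ∃ (m : ℕ) (c : USq → Fin m) (F : Fin m → Fin m → ℝ), m ≤ 4 ^ N ∧ Measurable c ∧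
      ∀ S T, MeasurableSet S → MeasurableSet T →
        |∫ p in S ×ˢ T, (W p.1 p.2 - F (c p.1) (c p.2))| ≤ δ := by
  by_contra! hcon
  have key : ∀ n ≤ N + 1, ∃ (m : ℕ) (c : USq → Fin m) (F : Fin m → Fin m → ℝ), m ≤ 4 ^ n ∧
      Measurable c ∧ ∫ p : USq × USq, (W p.1 p.2 - F (c p.1) (c p.2)) ^ 2 ≤ 1 - n * δ ^ 2 := by
    intro n
    induction n with
    | zero =>
      intro _
      refine ⟨1, fun _ => 0, fun _ _ => 0, by simp, measurable_const, ?_⟩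
      have h : ∫ p : USq × USq, (W p.1 p.2 - 0) ^ 2 ≤ ∫ p : USq × USq, (1 : ℝ) :=
        integral_mono_of_nonneg (Eventually.of_forall fun p => sq_nonneg _) (integrable_const _)
          (Eventually.of_forall fun p => by
            have := hW p.1 p.2
            simpa [abs_of_nonneg this.1] using this.2)
      simpa using h
    | succ n ih =>
      intro hn
      obtain ⟨m, c, F, hm, hc, hF⟩ := ih (by omega)
      obtain ⟨S, T, hS, hT, hST⟩ := hcon m c F (hm.trans (Nat.pow_le_pow_right (by norm_num)
        (by omega))) hc
      set g : USq × USq → ℝ := fun p => W p.1 p.2 - F (c p.1) (c p.2) with hg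
      have hFm : Measurable fun p : USq × USq => F (c p.1) (c p.2) :=
        (measurable_of_finite (Function.uncurry F)).comp
          ((hc.comp measurable_fst).prodMk (hc.comp measurable_snd))
      have hgm : Measurable g := hWm.sub hFm
      obtain ⟨C, hC⟩ : ∃ C, ∀ p, |g p| ≤ C := by
        refine ⟨1 + ∑ i, ∑ j, |F i j|, fun p => ?_⟩
        have h1 := hW p.1 p.2
        have h2 : |F (c p.1) (c p.2)| ≤ ∑ i, ∑ j, |F i j| :=
          (Finset.single_le_sum (f := fun j => |F (c p.1) j|) (fun j _ => abs_nonneg _)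
            (Finset.mem_univ (c p.2))).trans
          (Finset.single_le_sum (f := fun i => ∑ j, |F i j|)
            (fun i _ => Finset.sum_nonneg fun j _ => abs_nonneg _) (Finset.mem_univ (c p.1)))
        refine (abs_sub _ _).trans (add_le_add ?_ h2)
        rw [abs_of_nonneg h1.1]; exact h1.2
      have hgi : Integrable g := Integrable.of_bound hgm.aestronglyMeasurable C
        (Eventually.of_forall hC)
      have hg2i : Integrable fun p => g p ^ 2 :=
        Integrable.of_bound (hgm.pow_const 2).aestronglyMeasurable (C ^ 2)
          (Eventually.of_forall fun p => by
            rw [Real.norm_eq_abs, abs_pow]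
            exact pow_le_pow_left₀ (abs_nonneg _) (hC p) 2)
      have hSTm : MeasurableSet (S ×ˢ T) := hS.prod hT
      set t : ℝ := ∫ p in S ×ˢ T, g p with ht
      have hti : Integrable ((S ×ˢ T).indicator g) := hgi.indicator hSTm
      have h1i : Integrable ((S ×ˢ T).indicator fun _ : USq × USq => (1 : ℝ)) :=
        (integrable_const _).indicator hSTm
      have hexp : ∀ p, (g p - t * (S ×ˢ T).indicator (fun _ => 1) p) ^ 2 =
          g p ^ 2 - 2 * t * (S ×ˢ T).indicator g p + t ^ 2 * (S ×ˢ T).indicator (fun _ => 1) p := by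
        intro p
        by_cases hp : p ∈ S ×ˢ T
        · simp only [Set.indicator_of_mem hp]; ring
        · simp only [Set.indicator_of_notMem hp]; ring
      have hint : ∫ p, (g p - t * (S ×ˢ T).indicator (fun _ => 1) p) ^ 2 ≤
          1 - (n + 1 : ℕ) * δ ^ 2 := by
        have hsub : Integrable fun p => g p ^ 2 - 2 * t * (S ×ˢ T).indicator g p :=
          hg2i.sub (hti.const_mul _)
        simp_rw [hexp]
        rw [integral_add hsub (h1i.const_mul _),
          integral_sub hg2i (hti.const_mul _), integral_const_mul, integral_const_mul,
          integral_indicator hSTm, integral_indicator hSTm, setIntegral_const, ← ht]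
        have h1 : volume.real (S ×ˢ T) ≤ 1 := measureReal_le_one
        have h2 : δ ^ 2 ≤ t ^ 2 := by
          rw [← sq_abs t]; exact pow_le_pow_left₀ hδ.le hST.le 2
        have h3 : 0 ≤ t ^ 2 := sq_nonneg t
        push_cast
        simp only [smul_eq_mul, mul_one]
        nlinarith
      let e : Fin m × Bool × Bool ≃ Fin (m * 4) :=
        Fintype.equivFinOfCardEq (by simp)
      refine ⟨m * 4, fun u => e (c u, decide (u ∈ S), decide (u ∈ T)),
        fun x y => F (e.symm x).1 (e.symm y).1 +
          t * if (e.symm x).2.1 ∧ (e.symm y).2.2 then 1 else 0, ?_, ?_, ?_⟩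
      · rw [pow_succ]; exact Nat.mul_le_mul_right 4 hm
      · exact (measurable_of_finite e).comp (hc.prodMk ((measurable_to_bool (by
          convert hS using 1; ext; simp)).prodMk (measurable_to_bool (by
          convert hT using 1; ext; simp))))
      · refine le_of_eq_of_le (integral_congr_ae (Eventually.of_forall fun p => ?_)) hint
        simp only [Equiv.symm_apply_apply, decide_eq_true_eq, Set.indicator, Set.mem_prod, hg]
        ring
  obtain ⟨m, c, F, -, -, h⟩ := key (N + 1) le_rfl
  have h0 : 0 ≤ ∫ p : USq × USq, (W p.1 p.2 - F (c p.1) (c p.2)) ^ 2 :=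
    integral_nonneg fun p => sq_nonneg _
  push_cast at h
  linarith

theorem exists_subset_abs_sum_mul_le {ι : Type*} (s : Finset ι) {a : ι → ℝ}
    (ha : ∀ i, a i ∈ Set.Icc (0 : ℝ) 1) (x : ι → ℝ) :
    ∃ I ⊆ s, |∑ i ∈ s, a i * x i| ≤ |∑ i ∈ I, x i| := by
  have key : ∀ y : ι → ℝ, ∑ i ∈ s, a i * y i ≤ ∑ i ∈ s with 0 ≤ y i, y i := by
    intro y
    rw [Finset.sum_filter]
    refine Finset.sum_le_sum fun i _ => ?_
    split_ifs with h
    · exact mul_le_of_le_one_left h (ha i).2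
    · exact mul_nonpos_of_nonneg_of_nonpos (ha i).1 (not_le.1 h).le
  rcases abs_choice (∑ i ∈ s, a i * x i) with h | h <;> rw [h]
  · exact ⟨_, Finset.filter_subset _ _, (key x).trans (le_abs_self _)⟩
  · refine ⟨_, Finset.filter_subset (fun i => 0 ≤ -x i) _, ?_⟩
    have h1 := key fun i => -x i
    simp only [mul_neg, Finset.sum_neg_distrib] at h1
    exact h1.trans (neg_le_abs _)

theorem abs_sum_sum_mul_mul_le {ι : Type*} (s : Finset ι) {a b : ι → ℝ}
    (ha : ∀ i, a i ∈ Set.Icc (0 : ℝ) 1) (hb : ∀ i, b i ∈ Set.Icc (0 : ℝ) 1) {M : ι → ι → ℝ} {δ : ℝ}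
    (hM : ∀ I ⊆ s, ∀ J ⊆ s, |∑ i ∈ I, ∑ j ∈ J, M i j| ≤ δ) :
    |∑ i ∈ s, ∑ j ∈ s, a i * b j * M i j| ≤ δ := by
  obtain ⟨I, hI, hI'⟩ := exists_subset_abs_sum_mul_le s ha fun i => ∑ j ∈ s, b j * M i j
  obtain ⟨J, hJ, hJ'⟩ := exists_subset_abs_sum_mul_le s hb fun j => ∑ i ∈ I, M i j
  simp_rw [mul_assoc, ← Finset.mul_sum]
  refine hI'.trans ?_
  rw [Finset.sum_comm]
  simp_rw [← Finset.mul_sum]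
  refine hJ'.trans ?_
  rw [Finset.sum_comm]
  exact hM I hI J hJ

theorem stepping_apply_of_mem (W : USq → USq → ℝ) {q : ℕ} {Q : Fin q → Set USq}
    (hQd : Pairwise (Function.onFun Disjoint Q)) {i j : Fin q} {u v : USq} (hu : u ∈ Q i)
    (hv : v ∈ Q j) :
    stepping W Q u v =
      ((volume (Q i)).toReal * (volume (Q j)).toReal)⁻¹ * ∫ p in Q i ×ˢ Q j, W p.1 p.2 := by
  have hne : ∀ {w : USq} {a b : Fin q}, w ∈ Q a → b ≠ a →
      (Q b).indicator (fun _ => (1 : ℝ)) w = 0 := fun hw hab =>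
    Set.indicator_of_notMem (fun h => Set.disjoint_left.1 (hQd hab) h hw) _
  rw [stepping, Finset.sum_eq_single i (fun a _ ha => Finset.sum_eq_zero fun b _ => by
      rw [hne hu ha, zero_mul, zero_mul]) (by simp),
    Finset.sum_eq_single j (fun b _ hb => by rw [hne hv hb, mul_zero, zero_mul]) (by simp),
    Set.indicator_of_mem hu, Set.indicator_of_mem hv, one_mul, one_mul]

theorem measurable_stepping (W : USq → USq → ℝ) {q : ℕ} {Q : Fin q → Set USq}
    (hQm : ∀ j, MeasurableSet (Q j)) :
    Measurable fun p : USq × USq => stepping W Q p.1 p.2 := by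
  unfold stepping
  refine Finset.measurable_sum _ fun i _ => Finset.measurable_sum _ fun j _ => ?_
  exact (((measurable_const.indicator (hQm i)).comp measurable_fst).mul
    ((measurable_const.indicator (hQm j)).comp measurable_snd)).mul_const _

theorem stepping_mem_Icc {W : USq → USq → ℝ} (hW : ∀ u v, W u v ∈ Set.Icc (0 : ℝ) 1) {q : ℕ}
    {Q : Fin q → Set USq} (hQd : Pairwise (Function.onFun Disjoint Q))
    (hQu : (⋃ j, Q j) = Set.univ) (u v : USq) : stepping W Q u v ∈ Set.Icc (0 : ℝ) 1 := by
  obtain ⟨i, hi⟩ := Set.mem_iUnion.1 (hQu ▸ Set.mem_univ u)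
  obtain ⟨j, hj⟩ := Set.mem_iUnion.1 (hQu ▸ Set.mem_univ v)
  rw [stepping_apply_of_mem W hQd hi hj]
  have h0 : 0 ≤ ∫ p in Q i ×ˢ Q j, W p.1 p.2 := integral_nonneg fun p => (hW p.1 p.2).1
  have h1 : ∫ p in Q i ×ˢ Q j, W p.1 p.2 ≤ (volume (Q i)).toReal * (volume (Q j)).toReal := by
    have := norm_setIntegral_le_of_norm_le_const (μ := (volume : Measure (USq × USq)))
      (s := Q i ×ˢ Q j) (f := fun p => W p.1 p.2) (C := 1) (measure_lt_top _ _) fun p _ => by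
        rw [Real.norm_eq_abs, abs_of_nonneg (hW p.1 p.2).1]; exact (hW p.1 p.2).2
    rw [one_mul, Measure.volume_eq_prod, measureReal_prod_prod] at this
    exact (le_abs_self _).trans this
  exact ⟨by positivity, inv_mul_le_one_of_le₀ h1 (by positivity)⟩

theorem setIntegral_biUnion_prod_biUnion {q : ℕ} {X Y : Fin q → Set USq}
    (hXm : ∀ j, MeasurableSet (X j)) (hYm : ∀ j, MeasurableSet (Y j))
    (hXd : Pairwise (Function.onFun Disjoint X)) (hYd : Pairwise (Function.onFun Disjoint Y))
    {g : USq × USq → ℝ} (hg : Integrable g) (I J : Finset (Fin q)) :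
    ∫ p in (⋃ i ∈ I, X i) ×ˢ (⋃ j ∈ J, Y j), g p = ∑ i ∈ I, ∑ j ∈ J, ∫ p in X i ×ˢ Y j, g p := by
  have h : (⋃ i ∈ I, X i) ×ˢ (⋃ j ∈ J, Y j) = ⋃ x ∈ I ×ˢ J, X x.1 ×ˢ Y x.2 := by
    ext p
    simp only [Set.mem_prod, Set.mem_iUnion, Finset.mem_product, exists_prop, Prod.exists]
    grind
  rw [h, integral_biUnion_finset _ (fun x _ => (hXm _).prod (hYm _)) _
    fun x _ => hg.integrableOn, Finset.sum_product]
  rintro x - y - hxy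
  rcases eq_or_ne x.1 y.1 with h1 | h1
  · exact Set.disjoint_prod.2 (Or.inr (hYd fun h2 => hxy (Prod.ext h1 h2)))
  · exact Set.disjoint_prod.2 (Or.inl (hXd h1))

/-- If `W` is within `δ` in cut norm of a step function, then it is within `2 * δ` of its stepping
along an equipartition `Q`, up to an error from the cells of `Q` on which the steps vary. -/
theorem abs_setIntegral_sub_stepping_le {W : USq → USq → ℝ}
    (hWm : Measurable (Function.uncurry W)) (hW : ∀ u v, W u v ∈ Set.Icc (0 : ℝ) 1) {q m : ℕ}
    (hq : 0 < q) {Q : Fin q → Set USq} (hQm : ∀ j, MeasurableSet (Q j))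
    (hQd : Pairwise (Function.onFun Disjoint Q)) (hQu : (⋃ j, Q j) = Set.univ)
    (hQv : ∀ j, volume.real (Q j) = 1 / q) {c : USq → Fin m} (hc : Measurable c)
    {F : Fin m → Fin m → ℝ} {B : Finset (Fin q)} (hB : ∀ j ∉ B, ∃ l, Q j ⊆ c ⁻¹' {l}) {δ : ℝ}
    (hF : ∀ S T, MeasurableSet S → MeasurableSet T →
      |∫ p in S ×ˢ T, (W p.1 p.2 - F (c p.1) (c p.2))| ≤ δ)
    {S T : Set USq} (hS : MeasurableSet S) (hT : MeasurableSet T) :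
    |∫ p in S ×ˢ T, (W p.1 p.2 - stepping W Q p.1 p.2)| ≤ 2 * δ + 2 * (B.card / q) := by
  have hq' : (0 : ℝ) < q := by exact_mod_cast hq
  set V : USq × USq → ℝ := fun p => F (c p.1) (c p.2) with hV
  set D : USq × USq → ℝ := fun p => W p.1 p.2 - stepping W Q p.1 p.2 with hD
  have hVm : Measurable V := (measurable_of_finite (Function.uncurry F)).comp
    ((hc.comp measurable_fst).prodMk (hc.comp measurable_snd))
  have hVi : Integrable V := by
    refine Integrable.of_bound hVm.aestronglyMeasurable (∑ i, ∑ j, |F i j|)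
      (Eventually.of_forall fun p => ?_)
    exact (Finset.single_le_sum (f := fun j => |F (c p.1) j|) (fun j _ => abs_nonneg _)
        (Finset.mem_univ (c p.2))).trans
      (Finset.single_le_sum (f := fun i => ∑ j, |F i j|)
        (fun i _ => Finset.sum_nonneg fun j _ => abs_nonneg _) (Finset.mem_univ (c p.1)))
  have hWi : Integrable fun p : USq × USq => W p.1 p.2 :=
    Integrable.of_bound (f := fun p : USq × USq => W p.1 p.2) hWm.aestronglyMeasurable 1
      (Eventually.of_forall fun p => by
        rw [Real.norm_eq_abs, abs_of_nonneg (hW p.1 p.2).1]; exact (hW p.1 p.2).2)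
  have hD1 : ∀ p, |D p| ≤ 1 := fun p => by
    have h1 := hW p.1 p.2
    have h2 := stepping_mem_Icc hW hQd hQu p.1 p.2
    exact abs_le.2 ⟨by linarith [h1.1, h2.2], by linarith [h1.2, h2.1]⟩
  have hDi : Integrable D := Integrable.of_bound
    (hWm.sub (measurable_stepping W hQm)).aestronglyMeasurable 1 (Eventually.of_forall hD1)
  have hHi : Integrable fun p => W p.1 p.2 - V p := hWi.sub hVi
  set X : Set USq → Fin q → Set USq := fun S i => S ∩ Q i
  have hXm : ∀ {S}, MeasurableSet S → ∀ i, MeasurableSet (X S i) := fun hS i => hS.inter (hQm i)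
  have hXd : ∀ S, Pairwise (Function.onFun Disjoint (X S)) := fun S i j hij =>
    (hQd hij).mono Set.inter_subset_right Set.inter_subset_right
  have hUm : ∀ {S}, MeasurableSet S → MeasurableSet (⋃ i ∈ Bᶜ, X S i) := fun hS =>
    Finset.measurableSet_biUnion _ fun i _ => hXm hS i
  -- the part of `S` lying in the exceptional cells
  have hbad : ∀ S : Set USq, volume.real (S \ ⋃ i ∈ Bᶜ, X S i) ≤ B.card / q := by
    intro S
    have h1 : S \ (⋃ i ∈ Bᶜ, X S i) ⊆ ⋃ i ∈ B, Q i := by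
      intro u hu
      obtain ⟨i, hi⟩ := Set.mem_iUnion.1 (hQu ▸ Set.mem_univ u)
      simp only [Set.mem_iUnion, exists_prop]
      refine ⟨i, ?_, hi⟩
      by_contra hiB
      exact hu.2 (Set.mem_biUnion (Finset.mem_compl.2 hiB) ⟨hu.1, hi⟩)
    refine (measureReal_mono h1 (measure_ne_top _ _)).trans ((measureReal_biUnion_finset_le _ _).trans_eq ?_)
    simp only [hQv, Finset.sum_const, nsmul_eq_mul]
    ring
  set S' : Set USq := ⋃ i ∈ Bᶜ, X S i with hS'
  set T' : Set USq := ⋃ i ∈ Bᶜ, X T i with hT'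
  have hS'S : S' ⊆ S := Set.iUnion₂_subset fun i _ => Set.inter_subset_left
  have hT'T : T' ⊆ T := Set.iUnion₂_subset fun i _ => Set.inter_subset_left
  have hrest : |∫ p in (S ×ˢ T) \ (S' ×ˢ T'), D p| ≤ 2 * (B.card / q) := by
    have h1 := norm_setIntegral_le_of_norm_le_const (μ := (volume : Measure (USq × USq)))
      (s := (S ×ˢ T) \ (S' ×ˢ T')) (f := D) (C := 1) (measure_lt_top _ _) fun p _ => hD1 p
    have h2 : (S ×ˢ T) \ (S' ×ˢ T') ⊆ (S \ S') ×ˢ Set.univ ∪ Set.univ ×ˢ (T \ T') := by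
      rintro p ⟨⟨hp1, hp2⟩, hp3⟩
      by_cases h : p.1 ∈ S'
      · exact Or.inr ⟨trivial, hp2, fun h' => hp3 ⟨h, h'⟩⟩
      · exact Or.inl ⟨⟨hp1, h⟩, trivial⟩
    have h3 := (measureReal_mono (μ := (volume : Measure (USq × USq))) h2).trans
      (measureReal_union_le _ _)
    rw [Measure.volume_eq_prod, measureReal_prod_prod, measureReal_prod_prod, probReal_univ] at h3
    rw [Real.norm_eq_abs, one_mul] at h1
    rw [Measure.volume_eq_prod] at h1 ⊢
    linarith [hbad S, hbad T]
  -- on a product of good cells, `V` is constant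
  have hcell : ∀ i ∈ Bᶜ, ∀ j ∈ Bᶜ, ∫ p in X S i ×ˢ X T j, D p =
      (∫ p in X S i ×ˢ X T j, (W p.1 p.2 - V p)) -
        (q * volume.real (X S i)) * (q * volume.real (X T j)) *
          ∫ p in Q i ×ˢ Q j, (W p.1 p.2 - V p) := by
    intro i hi j hj
    obtain ⟨k, hk⟩ := hB i (Finset.mem_compl.1 hi)
    obtain ⟨l, hl⟩ := hB j (Finset.mem_compl.1 hj)
    have hVc : ∀ p ∈ Q i ×ˢ Q j, V p = F k l := fun p hp => by
      simp only [hV, show c p.1 = k from hk hp.1, show c p.2 = l from hl hp.2]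
    have hsub : X S i ×ˢ X T j ⊆ Q i ×ˢ Q j :=
      Set.prod_mono Set.inter_subset_right Set.inter_subset_right
    have hVint : ∀ {Y Z : Set USq}, MeasurableSet Y → MeasurableSet Z → Y ×ˢ Z ⊆ Q i ×ˢ Q j →
        ∫ p in Y ×ˢ Z, V p = volume.real Y * volume.real Z * F k l := by
      intro Y Z hY hZ h
      rw [setIntegral_congr_fun (hY.prod hZ) (fun p hp => hVc p (h hp)), setIntegral_const,
        Measure.volume_eq_prod, measureReal_prod_prod, smul_eq_mul]
    have hDint : ∫ p in X S i ×ˢ X T j, stepping W Q p.1 p.2 =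
        volume.real (X S i) * volume.real (X T j) * (q * q * ∫ p in Q i ×ˢ Q j, W p.1 p.2) := by
      rw [setIntegral_congr_fun (g := fun _ => q * q * ∫ p in Q i ×ˢ Q j, W p.1 p.2)
        ((hXm hS i).prod (hXm hT j)) (fun p hp => ?_), setIntegral_const,
        Measure.volume_eq_prod, measureReal_prod_prod, smul_eq_mul]
      simp only [stepping_apply_of_mem W hQd (hsub hp).1 (hsub hp).2, ← measureReal_def, hQv]
      congr 1
      field_simp
    have hsi : Integrable fun p : USq × USq => stepping W Q p.1 p.2 :=
      (hWi.sub hDi).congr (Eventually.of_forall fun p => by simp [hD])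
    rw [integral_sub hWi.integrableOn hsi.integrableOn,
      integral_sub hWi.integrableOn hVi.integrableOn,
      integral_sub hWi.integrableOn hVi.integrableOn, hDint,
      hVint (hXm hS i) (hXm hT j) hsub, hVint (hQm i) (hQm j) subset_rfl, hQv, hQv]
    field_simp
    ring
  have hcoef : ∀ (S : Set USq) (i : Fin q), q * volume.real (X S i) ∈ Set.Icc (0 : ℝ) 1 := by
    intro S i
    refine ⟨by positivity, ?_⟩
    have h := measureReal_mono (μ := volume) (Set.inter_subset_right : X S i ⊆ Q i)
    rw [hQv, le_div_iff₀ hq'] at h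
    linarith
  have hsum := abs_sum_sum_mul_mul_le Bᶜ (hcoef S) (hcoef T)
    (M := fun i j => ∫ p in Q i ×ˢ Q j, (W p.1 p.2 - V p)) (δ := δ) fun I _ J _ => by
      rw [← setIntegral_biUnion_prod_biUnion hQm hQm hQd hQd hHi I J]
      exact hF _ _ (Finset.measurableSet_biUnion _ fun i _ => hQm i)
        (Finset.measurableSet_biUnion _ fun i _ => hQm i)
  have hgood : ∫ p in S' ×ˢ T', D p = (∫ p in S' ×ˢ T', (W p.1 p.2 - V p)) -
      ∑ i ∈ Bᶜ, ∑ j ∈ Bᶜ, (q * volume.real (X S i)) * (q * volume.real (X T j)) *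
        ∫ p in Q i ×ˢ Q j, (W p.1 p.2 - V p) := by
    rw [hS', hT', setIntegral_biUnion_prod_biUnion (hXm hS) (hXm hT) (hXd S) (hXd T) hDi,
      setIntegral_biUnion_prod_biUnion (hXm hS) (hXm hT) (hXd S) (hXd T) hHi,
      ← Finset.sum_sub_distrib]
    refine Finset.sum_congr rfl fun i hi => ?_
    rw [← Finset.sum_sub_distrib]
    exact Finset.sum_congr rfl fun j hj => hcell i hi j hj
  have hsplit := integral_inter_add_sdiff (s := S ×ˢ T) (f := D)
    ((hUm hS).prod (hUm hT)) hDi.integrableOn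
  rw [Set.inter_eq_right.2 (Set.prod_mono hS'S hT'T)] at hsplit
  rw [← hsplit, hgood]
  have hH := hF S' T' (hUm hS) (hUm hT)
  refine (abs_add_le _ _).trans ?_
  have := abs_sub (∫ p in S' ×ˢ T', (W p.1 p.2 - V p))
    (∑ i ∈ Bᶜ, ∑ j ∈ Bᶜ, (q * volume.real (X S i)) * (q * volume.real (X T j)) *
        ∫ p in Q i ×ˢ Q j, (W p.1 p.2 - V p))
  linarith

/-- Equipartition refinement lemma: given an equipartition `P` of `[0,1]²` into `k` sets
and `q ≥ 2k²·2^{162/ε²}` divisible by `k`, every orderon `W` admits an equipartition `Q`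
into `q` sets refining `P` (up to null sets) with `‖W - W_Q‖_□ ≤ 8ε/9 + 2/k`. -/
theorem equipartition_refinement (ε : ℝ) (hε : 0 < ε) (k q : ℕ) (hk : 0 < k)
    (P : Fin k → Set USq) (hPm : ∀ i, MeasurableSet (P i))
    (hPd : Pairwise (Function.onFun Disjoint P)) (hPu : (⋃ i, P i) = Set.univ)
    (hPe : ∀ i, volume (P i) = 1 / (k : ℝ≥0∞))
    (hdvd : k ∣ q) (hq : (2 * (k:ℝ)^2) * 2 ^ ((162:ℝ) / ε^2) ≤ (q : ℝ))
    (W : USq → USq → ℝ) (hW : IsOrderon W) :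
    ∃ Q : Fin q → Set USq, (∀ j, MeasurableSet (Q j)) ∧
      Pairwise (Function.onFun Disjoint Q) ∧ (⋃ j, Q j) = Set.univ ∧
      (∀ j, volume (Q j) = 1 / (q : ℝ≥0∞)) ∧
      (∀ j : Fin q, ∃ i : Fin k, volume (Q j \ P i) = 0) ∧
      cutNorm (fun u v => W u v - stepping W Q u v) ≤ 8 * ε / 9 + 2 / (k : ℝ) := by
  have hkR : (0 : ℝ) < k := by exact_mod_cast hk
  have hqpos : (0 : ℝ) < q := lt_of_lt_of_le (by positivity) hq
  obtain ⟨n, rfl⟩ := hdvd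
  obtain ⟨N, rfl⟩ : ∃ N, n = N + 1 := Nat.exists_eq_succ_of_ne_zero fun h => by simp [h] at hqpos
  have hδ : 0 < ε / 9 := by positivity
  have hx : (0 : ℝ) ≤ 81 / ε ^ 2 := by positivity
  obtain ⟨m, c, F, hm, hc, hF⟩ := exists_step_approx hW.1 hW.2.1 hδ
    (N := ⌊(81 : ℝ) / ε ^ 2⌋₊) (by
      have h := Nat.lt_floor_add_one ((81 : ℝ) / ε ^ 2)
      rw [div_lt_iff₀ (by positivity)] at h
      rw [div_pow, mul_div_assoc', lt_div_iff₀ (by norm_num)]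
      linarith)
  have hmR : (m : ℝ) ≤ 2 ^ ((162 : ℝ) / ε ^ 2) := by
    have h1 : (m : ℝ) ≤ 4 ^ ⌊(81 : ℝ) / ε ^ 2⌋₊ := by exact_mod_cast hm
    refine h1.trans ?_
    rw [← Real.rpow_natCast, show (162 : ℝ) / ε ^ 2 = 2 * (81 / ε ^ 2) by ring,
      Real.rpow_mul (by norm_num)]
    rw [show (2 : ℝ) ^ (2 : ℝ) = 4 by norm_num]
    exact Real.rpow_le_rpow_of_exponent_le (by norm_num) (Nat.floor_le hx)
  have hPr : ∀ i, volume.real (P i) = (N + 1) * (1 / (k * (N + 1) : ℕ) : ℝ) := fun i => by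
    rw [measureReal_def, hPe i]
    simp
    field_simp
  have hδq : 0 < (1 / (k * (N + 1) : ℕ) : ℝ) := by positivity
  choose Q B hQm hQd hQu hQv hB hQc using fun i =>
    exists_equipartition_subordinate hc hδq N (hPm i) (hPr i)
  have hQP : ∀ i j, Q i j ⊆ P i := fun i j => hQu i ▸ Set.subset_iUnion (Q i) j
  let e : Fin (k * (N + 1)) ≃ Fin k × Fin (N + 1) := finProdFinEquiv.symm
  let R : Fin (k * (N + 1)) → Set USq := fun j => Q (e j).1 (e j).2
  let B' : Finset (Fin (k * (N + 1))) := (Finset.univ.sigma B).map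
    ((Equiv.sigmaEquivProd _ _).trans e.symm).toEmbedding
  have hB' : B'.card ≤ k * m := by
    rw [Finset.card_map, Finset.card_sigma]
    exact (Finset.sum_le_sum fun i _ => hB i).trans_eq (by simp)
  have hRm : ∀ j, MeasurableSet (R j) := fun j => hQm _ _
  have hRd : Pairwise (Function.onFun Disjoint R) := by
    intro i j hij
    by_cases h : (e i).1 = (e j).1
    · have h2 : (e i).2 ≠ (e j).2 := fun h2 => hij (e.injective (Prod.ext h h2))
      simpa only [Function.onFun, R, h] using hQd (e j).1 h2
    · exact (hPd h).mono (hQP _ _) (hQP _ _)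
  have hRu : (⋃ j, R j) = Set.univ := by
    rw [← hPu, e.surjective.iUnion_comp (fun x => Q x.1 x.2), Set.iUnion_prod']
    exact Set.iUnion_congr hQu
  have hRv : ∀ j, volume.real (R j) = 1 / (k * (N + 1) : ℕ) := fun j => hQv _ _
  refine ⟨R, hRm, hRd, hRu, fun j => ?_, fun j => ⟨(e j).1, ?_⟩, ?_⟩
  · rw [← ENNReal.toReal_eq_toReal_iff' (measure_ne_top _ _)
      (ENNReal.div_ne_top ENNReal.one_ne_top (by exact_mod_cast (Nat.cast_pos.1 hqpos).ne')),
      ← measureReal_def, hRv, ENNReal.toReal_div, ENNReal.toReal_one, ENNReal.toReal_natCast]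
  · rw [Set.sdiff_eq_empty.2 (hQP _ _), measure_empty]
  · refine csSup_le ⟨_, ∅, ∅, MeasurableSet.empty, MeasurableSet.empty, rfl⟩ ?_
    rintro _ ⟨S, T, hS, hT, rfl⟩
    refine (abs_setIntegral_sub_stepping_le hW.1 hW.2.1 (by positivity) hRm hRd hRu hRv hc (B := B')
      (fun j hj => hQc _ _ fun h => hj ?_) hF hS hT).trans ?_
    · refine Finset.mem_map.2 ⟨⟨(e j).1, (e j).2⟩, by simpa using h, by simp⟩
    · have h1 : (B'.card : ℝ) / (k * (N + 1) : ℕ) ≤ 1 / k := by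
        rw [div_le_div_iff₀ hqpos hkR]
        have h2 : (B'.card : ℝ) ≤ k * m := by exact_mod_cast hB'
        have h3 := mul_le_mul_of_nonneg_left hmR (by positivity : 0 ≤ (k : ℝ) ^ 2)
        have h4 := mul_le_mul_of_nonneg_right h2 hkR.le
        nlinarith [sq_nonneg (k : ℝ), Real.rpow_nonneg (zero_le_two (α := ℝ)) (162 / ε ^ 2)]
      have h5 : 2 * (1 / (k : ℝ)) = 2 / k := by ring
      linarith
end
end
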